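/- arXiv:1501.03000 — 3 statements merged into one kernel-verified Lean document; each statement's English description precedes it below -/
import Mathlib

section
/- Let γ ∈ (0,1], T > 0. Let b ∈ L^∞([0,T]; C^2_b(ℝ^d;ℝ^d)), let X, Y : [0,T] → ℝ^d be γ-Hölder continuous with X_0 = Y_0 = 0, and let Φ^X, Φ^Y be the unique flows of Φ_t(x) = x + ∫_0^t b_r(Φ_r(x)) dr + X_t (respectively with Y). Then for every t ∈ [0,T] and x ∈ ℝ^d the spatial derivatives DΦ^X_t(x), DΦ^Y_t(x) ∈ L(ℝ^d,ℝ^d) exist, and there is a constant C, depending only on T, sup_t ‖Db_t‖_∞ and sup_t ‖D²b_t‖_∞ and nondecreasing in each, such that for every x ∈ ℝ^d: sup_{t∈[0,T]} |DΦ^X_t(x) − DΦ^Y_t(x)| + sup_{s≠t∈[0,T]} |(DΦ^X_t(x) − DΦ^Y_t(x)) − (DΦ^X_s(x) − DΦ^Y_s(x))|/|t−s| ≤ C ‖X − Y‖_γ. -/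
open MeasureTheory Set Function

noncomputable section

abbrev Euc (d : ℕ) : Type := EuclideanSpace ℝ (Fin d)

section FiniteDifferences

open Filter Topology

variable {E F : Type*} [NormedAddCommGroup E] [NormedSpace ℝ E]
  [NormedAddCommGroup F] [NormedSpace ℝ F]

/-- A map that is additive up to a bilinear error and has linear growth is differentiable at the
origin. -/
theorem exists_hasFDerivAt_zero_of_almost_additive [CompleteSpace F] {R : E → F} {K L : ℝ}
    (hadd : ∀ y z, ‖R (y + z) - R y - R z‖ ≤ K * ‖y‖ * ‖z‖) (hR : ∀ y, ‖R y‖ ≤ L * ‖y‖) :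
    ∃ A : E →L[ℝ] F, HasFDerivAt R A 0 := by
  let a : E → ℕ → F := fun v n => (2 : ℝ) ^ n • R ((2 : ℝ)⁻¹ ^ n • v)
  have hstep : ∀ v n, dist (a v n) (a v (n + 1)) ≤ (K * ‖v‖ ^ 2 / 2) / 2 / 2 ^ n := by
    intro v n
    set w : E := (2 : ℝ)⁻¹ ^ (n + 1) • v with hw
    have hww : (2 : ℝ)⁻¹ ^ n • v = w + w := by
      rw [hw, ← add_smul]
      congr 1
      ring
    have hd : a v n - a v (n + 1) = (2 : ℝ) ^ n • (R (w + w) - R w - R w) := by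
      simp only [a, hww, ← hw]
      module
    have hnw : ‖w‖ = (2 : ℝ)⁻¹ ^ (n + 1) * ‖v‖ := by
      rw [hw, norm_smul, norm_pow, norm_inv, Real.norm_ofNat]
    rw [dist_eq_norm, hd, norm_smul, norm_pow, Real.norm_ofNat]
    calc (2 : ℝ) ^ n * ‖R (w + w) - R w - R w‖
        ≤ 2 ^ n * (K * ‖w‖ * ‖w‖) := by gcongr; exact hadd w w
      _ = (K * ‖v‖ ^ 2 / 2) / 2 / 2 ^ n := by
        rw [hnw, inv_pow]
        field_simp
        ring
  have hlim : ∀ v, ∃ l, Tendsto (a v) atTop (𝓝 l) := fun v =>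
    cauchySeq_tendsto_of_complete (cauchySeq_of_le_geometric_two (hstep v))
  choose A hA using hlim
  have hnorm : ∀ (v : E) (n : ℕ), ‖(2 : ℝ)⁻¹ ^ n • v‖ = (2 : ℝ)⁻¹ ^ n * ‖v‖ := fun v n => by
    rw [norm_smul, norm_pow, norm_inv, Real.norm_ofNat]
  have hA_add : ∀ v w, A (v + w) = A v + A w := by
    intro v w
    have h0 : Tendsto (fun n => a (v + w) n - a v n - a w n) atTop (𝓝 0) := by
      have hz : Tendsto (fun n : ℕ => K * ‖v‖ * ‖w‖ * (2 : ℝ)⁻¹ ^ n) atTop (𝓝 0) := by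
        simpa using (tendsto_pow_atTop_nhds_zero_of_lt_one (r := (2 : ℝ)⁻¹) (by norm_num)
          (by norm_num)).const_mul (K * ‖v‖ * ‖w‖)
      refine squeeze_zero_norm (fun n => ?_) hz
      have hd : a (v + w) n - a v n - a w n = (2 : ℝ) ^ n •
          (R ((2 : ℝ)⁻¹ ^ n • v + (2 : ℝ)⁻¹ ^ n • w) - R ((2 : ℝ)⁻¹ ^ n • v)
            - R ((2 : ℝ)⁻¹ ^ n • w)) := by
        simp only [a, smul_add, smul_sub]
      rw [hd, norm_smul, norm_pow, Real.norm_ofNat]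
      calc _ ≤ (2 : ℝ) ^ n * (K * ‖(2 : ℝ)⁻¹ ^ n • v‖ * ‖(2 : ℝ)⁻¹ ^ n • w‖) := by
            gcongr
            exact hadd _ _
        _ = K * ‖v‖ * ‖w‖ * (2 : ℝ)⁻¹ ^ n := by
            rw [hnorm, hnorm, inv_pow]
            field_simp
    have := tendsto_nhds_unique h0 (((hA (v + w)).sub (hA v)).sub (hA w))
    rw [sub_sub, eq_comm, sub_eq_zero] at this
    exact this
  have hA_bound : ∀ v, ‖A v‖ ≤ L * ‖v‖ := by
    intro v
    refine le_of_tendsto' (hA v).norm fun n => ?_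
    rw [norm_smul, norm_pow, Real.norm_ofNat]
    calc _ ≤ (2 : ℝ) ^ n * (L * ‖(2 : ℝ)⁻¹ ^ n • v‖) := by
          gcongr
          exact hR _
      _ = L * ‖v‖ := by
          rw [hnorm, inv_pow]
          field_simp
  let A₀ : E →+ F := AddMonoidHom.mk' A hA_add
  have hA₀ : Continuous A₀ := AddMonoidHomClass.continuous_of_bound A₀ L hA_bound
  refine ⟨A₀.toRealLinearMap hA₀, ?_⟩
  have hR0 : R 0 = 0 := by simpa using hR 0
  refine HasFDerivAt.of_isLittleO ?_
  have hO : (fun v => R v - R 0 - (A₀.toRealLinearMap hA₀) (v - 0)) =O[𝓝 0]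
      fun v : E => ‖v - 0‖ ^ 2 := by
    refine Asymptotics.IsBigO.of_bound (K / 2) (Eventually.of_forall fun v => ?_)
    have := dist_le_of_le_geometric_two_of_tendsto₀ (hstep v) (hA v)
    simp only [a, pow_zero, one_smul, dist_eq_norm] at this
    rw [hR0, sub_zero, sub_zero, norm_pow, norm_norm]
    calc _ ≤ K * ‖v‖ ^ 2 / 2 := this
      _ = K / 2 * ‖v‖ ^ 2 := by ring
  refine hO.trans_isLittleO ?_
  simpa using Asymptotics.isLittleO_norm_pow_id (E' := E) one_lt_two

/-- Second-order finite difference bound for a function with bounded first two derivatives. -/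
theorem norm_four_point_le {f : E → F} {M N : ℝ} (hf : Differentiable ℝ f)
    (hM : ∀ x y, ‖f x - f y‖ ≤ M * ‖x - y‖)
    (hN : ∀ x y, ‖fderiv ℝ f x - fderiv ℝ f y‖ ≤ N * ‖x - y‖) (x₁ x₂ x₃ x₄ : E) :
    ‖(f x₁ - f x₂) - (f x₃ - f x₄)‖ ≤
      M * ‖(x₁ - x₂) - (x₃ - x₄)‖ + N * (‖x₁ - x₂‖ * ‖x₂ - x₄‖) := by
  set u := x₁ - x₂ with hu
  have hg : ∀ z, HasFDerivAt (fun z => f (z + u) - f z) (fderiv ℝ f (z + u) - fderiv ℝ f z) z :=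
    fun z => ((hasFDerivAt_comp_add_right u).2 (hf (z + u)).hasFDerivAt).sub (hf z).hasFDerivAt
  have hmv := convex_univ.norm_image_sub_le_of_norm_hasFDerivWithin_le
    (C := N * ‖u‖) (fun z _ => (hg z).hasFDerivWithinAt)
    (fun z _ => by simpa using hN (z + u) z) (mem_univ x₄) (mem_univ x₂)
  have hx : x₂ + u = x₁ := by rw [hu]; abel
  rw [hx] at hmv
  have h2 := hM (x₄ + u) x₃
  have e : (f x₁ - f x₂) - (f x₃ - f x₄)
      = (f (x₄ + u) - f x₃) + (f x₁ - f x₂ - (f (x₄ + u) - f x₄)) := by abel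
  have e2 : x₄ + u - x₃ = u - (x₃ - x₄) := by abel
  rw [e2] at h2
  rw [e]
  calc _ ≤ _ := norm_add_le _ _
    _ ≤ _ := add_le_add h2 hmv
    _ = _ := by ring

end FiniteDifferences

section Gronwall

open Filter Topology

theorem le_mul_exp_of_le_add_integral {u : ℝ → ℝ} {T k a : ℝ} (ha : 0 ≤ a) (hk : 0 ≤ k)
    (hu : ContinuousOn u (Icc 0 T)) (hu0 : ∀ t ∈ Icc 0 T, 0 ≤ u t)
    (h : ∀ t ∈ Icc 0 T, u t ≤ a + k * ∫ r in (0 : ℝ)..t, u r) :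
    ∀ t ∈ Icc 0 T, u t ≤ a * Real.exp (k * t) := by
  intro t ht
  have hT : 0 ≤ T := ht.1.trans ht.2
  set v : ℝ → ℝ := IccExtend hT (domRestrict (Icc 0 T) u) with hv
  have hvc : Continuous v := (continuousOn_iff_continuous_domRestrict.1 hu).Icc_extend'
  have hvu : ∀ s ∈ Icc 0 T, v s = u s := fun s hs => IccExtend_of_mem hT _ hs
  set G : ℝ → ℝ := fun s => a + k * ∫ r in (0 : ℝ)..s, v r with hG
  have hGd : ∀ s, HasDerivAt G (k * v s) s := fun s =>
    ((hvc.integral_hasStrictDerivAt 0 s).hasDerivAt.const_mul k).const_add a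
  have hvG : ∀ s ∈ Icc 0 T, v s ≤ G s := by
    intro s hs
    rw [hvu s hs]
    refine (h s hs).trans_eq ?_
    rw [hG]
    simp only
    congr 2
    refine intervalIntegral.integral_congr fun r hr => (hvu r ?_).symm
    rw [uIcc_of_le hs.1] at hr
    exact ⟨hr.1, hr.2.trans hs.2⟩
  have hbound := norm_le_gronwallBound_of_norm_deriv_right_le (f := G) (f' := fun s => k * v s)
    (δ := a) (K := k) (ε := 0) (a := 0) (b := T)
    (fun s _ => (hGd s).continuousAt.continuousWithinAt)
    (fun s _ => (hGd s).hasDerivWithinAt) (by simp [hG, abs_of_nonneg ha])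
    (fun s hs => by
      have hs' := Ico_subset_Icc_self hs
      have hvs : 0 ≤ v s := by rw [hvu s hs']; exact hu0 s hs'
      rw [norm_mul, Real.norm_of_nonneg hk, Real.norm_of_nonneg hvs, add_zero]
      gcongr
      exact (hvG s hs').trans (Real.le_norm_self _)) t ht
  rw [gronwallBound_ε0, sub_zero] at hbound
  rw [← hvu t ht]
  exact (hvG t ht).trans ((Real.le_norm_self _).trans hbound)

/-- Integral Grönwall inequality for a vector-valued function. -/
theorem norm_le_mul_exp_of_eq_add_integral {E : Type*} [NormedAddCommGroup E] [NormedSpace ℝ E]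
    {u g v : ℝ → E} {T k a c : ℝ} (ha : 0 ≤ a) (hk : 0 ≤ k) (hc : 0 ≤ c)
    (hu : ContinuousOn u (Icc 0 T)) (hg : ∀ t ∈ Icc 0 T, ‖g t‖ ≤ a)
    (h : ∀ t ∈ Icc 0 T, u t = g t + ∫ r in (0 : ℝ)..t, v r)
    (hv : ∀ t ∈ Icc 0 T, ‖v t‖ ≤ k * ‖u t‖ + c) :
    ∀ t ∈ Icc 0 T, ‖u t‖ ≤ (a + T * c) * Real.exp (k * T) := by
  intro t ht
  have hT : 0 ≤ T := ht.1.trans ht.2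
  have key := le_mul_exp_of_le_add_integral (u := fun t => ‖u t‖) (a := a + T * c)
    (by positivity) hk hu.norm (fun t _ => norm_nonneg _) (fun s hs => ?_) t ht
  · refine key.trans ?_
    gcongr
    exact ht.2
  · have hsub : Icc 0 s ⊆ Icc 0 T := Icc_subset_Icc_right hs.2
    have hint : IntervalIntegrable (fun r => ‖u r‖) volume 0 s :=
      ContinuousOn.intervalIntegrable (by rw [uIcc_of_le hs.1]; exact hu.norm.mono hsub)
    have hi := intervalIntegral.norm_integral_le_of_norm_le (f := v)
      (g := fun r => k * ‖u r‖ + c) hs.1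
      (Eventually.of_forall fun r hr => hv r (hsub (Ioc_subset_Icc_self hr)))
      ((hint.const_mul k).add intervalIntegrable_const)
    rw [intervalIntegral.integral_add (hint.const_mul k) intervalIntegrable_const,
      intervalIntegral.integral_const_mul, intervalIntegral.integral_const, sub_zero,
      smul_eq_mul] at hi
    have hsc : s * c ≤ T * c := by gcongr; exact hs.2
    have h1 := norm_add_le (g s) (∫ r in (0 : ℝ)..s, v r)
    have h2 := hg s hs
    rw [h s hs] at *
    linarith

end Gronwall

section Trajectories

variable {E : Type*} [NormedAddCommGroup E] [NormedSpace ℝ E] [MeasurableSpace E]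

/-- Bounded measurable drifts on `[0,T]` whose first and second finite differences in space are
controlled by `M` and `N`. -/
structure IsRegularDrift (b : ℝ → E → E) (T M N : ℝ) : Prop where
  measurable : Measurable (uncurry b)
  bounded : ∃ C, ∀ t ∈ Icc 0 T, ∀ x, ‖b t x‖ ≤ C
  nonneg_left : 0 ≤ M
  nonneg_right : 0 ≤ N
  lipschitz : ∀ t ∈ Icc 0 T, ∀ x y, ‖b t x - b t y‖ ≤ M * ‖x - y‖
  four_point : ∀ t ∈ Icc 0 T, ∀ x₁ x₂ x₃ x₄, ‖(b t x₁ - b t x₂) - (b t x₃ - b t x₄)‖ ≤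
    M * ‖(x₁ - x₂) - (x₃ - x₄)‖ + N * (‖x₁ - x₂‖ * ‖x₂ - x₄‖)

/-- `f` is a continuous solution on `[0,T]` of `f t = g t + ∫₀ᵗ b r (f r) dr`. -/
structure IsTrajectory (b : ℝ → E → E) (T : ℝ) (g f : ℝ → E) : Prop where
  continuousOn : ContinuousOn f (Icc 0 T)
  eq_add_integral : ∀ t ∈ Icc 0 T, f t = g t + ∫ r in (0 : ℝ)..t, b r (f r)

theorem isRegularDrift_of_contDiff {b : ℝ → E → E} {T M N : ℝ} (hT : 0 ≤ T)
    (hb : Measurable (uncurry b)) (hb2 : ∀ t ∈ Icc 0 T, ContDiff ℝ 2 (b t))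
    (hbd : ∃ C, ∀ t ∈ Icc 0 T, ∀ x, ‖b t x‖ ≤ C)
    (hM : ∀ t ∈ Icc 0 T, ∀ x, ‖fderiv ℝ (b t) x‖ ≤ M)
    (hN : ∀ t ∈ Icc 0 T, ∀ x, ‖iteratedFDeriv ℝ 2 (b t) x‖ ≤ N) :
    IsRegularDrift b T M N := by
  have hlip : ∀ t ∈ Icc 0 T, ∀ x y, ‖b t x - b t y‖ ≤ M * ‖x - y‖ := fun t ht x y =>
    convex_univ.norm_image_sub_le_of_norm_fderiv_le
      (fun z _ => (hb2 t ht).differentiable (by norm_num) z) (fun z _ => hM t ht z)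
      (mem_univ y) (mem_univ x)
  have h0 : (0 : ℝ) ∈ Icc 0 T := ⟨le_rfl, hT⟩
  refine ⟨hb, hbd, (norm_nonneg _).trans (hM 0 h0 0), (norm_nonneg _).trans (hN 0 h0 0), hlip,
    fun t ht => norm_four_point_le ((hb2 t ht).differentiable (by norm_num)) (hlip t ht)
      fun x y => ?_⟩
  have hd : Differentiable ℝ (fderiv ℝ (b t)) :=
    ((hb2 t ht).fderiv_right (m := 1) (by norm_num)).differentiable (by norm_num)
  refine convex_univ.norm_image_sub_le_of_norm_fderiv_le (fun z _ => hd z) (fun z _ => ?_)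
    (mem_univ y) (mem_univ x)
  rw [← norm_iteratedFDeriv_one, norm_iteratedFDeriv_fderiv]
  exact hN t ht z

variable {b : ℝ → E → E} {T M N : ℝ}

section

variable [BorelSpace E] [SecondCountableTopology E]

theorem IsRegularDrift.intervalIntegrable (hb : IsRegularDrift b T M N) {g f : ℝ → E}
    (hf : IsTrajectory b T g f) {s t : ℝ} (hs : s ∈ Icc 0 T) (ht : t ∈ Icc 0 T) :
    IntervalIntegrable (fun r => b r (f r)) volume s t := by
  obtain ⟨C, hC⟩ := hb.bounded
  have hm : AEMeasurable f (volume.restrict (Icc 0 T)) :=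
    hf.continuousOn.aemeasurable measurableSet_Icc
  have hm' : AEMeasurable (fun r => b r (f r)) (volume.restrict (Icc 0 T)) :=
    hb.measurable.comp_aemeasurable (aemeasurable_id.prodMk hm)
  have hi : IntegrableOn (fun r => b r (f r)) (Icc 0 T) :=
    .of_bound (by simp) hm'.aestronglyMeasurable C
      ((ae_restrict_iff' measurableSet_Icc).2 (.of_forall fun r hr => hC r hr _))
  exact (hi.mono_set (OrdConnected.uIcc_subset ordConnected_Icc hs ht)).intervalIntegrable

theorem IsRegularDrift.sub_eq (hb : IsRegularDrift b T M N) {g₁ g₂ f₁ f₂ : ℝ → E}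
    (h₁ : IsTrajectory b T g₁ f₁) (h₂ : IsTrajectory b T g₂ f₂) {t : ℝ} (ht : t ∈ Icc 0 T) :
    f₁ t - f₂ t = (g₁ t - g₂ t) + ∫ r in (0 : ℝ)..t, (b r (f₁ r) - b r (f₂ r)) := by
  have h0 : (0 : ℝ) ∈ Icc 0 T := ⟨le_rfl, ht.1.trans ht.2⟩
  rw [intervalIntegral.integral_sub (hb.intervalIntegrable h₁ h0 ht)
    (hb.intervalIntegrable h₂ h0 ht), h₁.eq_add_integral t ht, h₂.eq_add_integral t ht]
  abel

theorem IsRegularDrift.norm_sub_le (hb : IsRegularDrift b T M N) {g₁ g₂ f₁ f₂ : ℝ → E}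
    (h₁ : IsTrajectory b T g₁ f₁) (h₂ : IsTrajectory b T g₂ f₂) {a : ℝ} (ha : 0 ≤ a)
    (hg : ∀ t ∈ Icc 0 T, ‖g₁ t - g₂ t‖ ≤ a) {t : ℝ} (ht : t ∈ Icc 0 T) :
    ‖f₁ t - f₂ t‖ ≤ a * Real.exp (M * T) := by
  simpa using norm_le_mul_exp_of_eq_add_integral (u := fun t => f₁ t - f₂ t) (c := 0)
    (v := fun r => b r (f₁ r) - b r (f₂ r))
    ha hb.nonneg_left le_rfl (h₁.continuousOn.sub h₂.continuousOn) hg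
    (fun t ht => hb.sub_eq h₁ h₂ ht) (fun t ht => by simpa using hb.lipschitz t ht _ _) t ht

/-- Grönwall estimate for the mixed difference of four trajectories with compatible data. -/
theorem IsRegularDrift.norm_four_point_le (hb : IsRegularDrift b T M N)
    {g₁ g₂ g₃ g₄ f₁ f₂ f₃ f₄ : ℝ → E}
    (h₁ : IsTrajectory b T g₁ f₁) (h₂ : IsTrajectory b T g₂ f₂)
    (h₃ : IsTrajectory b T g₃ f₃) (h₄ : IsTrajectory b T g₄ f₄)
    (hg : ∀ t ∈ Icc 0 T, g₁ t - g₂ t = g₃ t - g₄ t) {p q : ℝ} (hp : 0 ≤ p) (hq : 0 ≤ q)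
    (h₁₂ : ∀ t ∈ Icc 0 T, ‖f₁ t - f₂ t‖ ≤ p) (h₂₄ : ∀ t ∈ Icc 0 T, ‖f₂ t - f₄ t‖ ≤ q)
    {s t : ℝ} (hs : s ∈ Icc 0 T) (ht : t ∈ Icc 0 T) :
    ‖(f₁ t - f₂ t) - (f₃ t - f₄ t)‖ ≤ T * (N * (p * q)) * Real.exp (M * T) ∧
    ‖((f₁ t - f₂ t) - (f₃ t - f₄ t)) - ((f₁ s - f₂ s) - (f₃ s - f₄ s))‖ ≤
      (M * (T * (N * (p * q)) * Real.exp (M * T)) + N * (p * q)) * |t - s| := by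
  set v : ℝ → E := fun r => (b r (f₁ r) - b r (f₂ r)) - (b r (f₃ r) - b r (f₄ r)) with hv
  set u : ℝ → E := fun r => (f₁ r - f₂ r) - (f₃ r - f₄ r) with hu
  have hN := hb.nonneg_right
  have hM := hb.nonneg_left
  have hint : ∀ {s t : ℝ}, s ∈ Icc 0 T → t ∈ Icc 0 T → IntervalIntegrable v volume s t :=
    fun hs ht => ((hb.intervalIntegrable h₁ hs ht).sub (hb.intervalIntegrable h₂ hs ht)).sub
      ((hb.intervalIntegrable h₃ hs ht).sub (hb.intervalIntegrable h₄ hs ht))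
  have h0 : (0 : ℝ) ∈ Icc 0 T := ⟨le_rfl, ht.1.trans ht.2⟩
  have hueq : ∀ t ∈ Icc 0 T, u t = ∫ r in (0 : ℝ)..t, v r := by
    intro t ht
    rw [hv, intervalIntegral.integral_sub
      ((hb.intervalIntegrable h₁ h0 ht).sub (hb.intervalIntegrable h₂ h0 ht))
      ((hb.intervalIntegrable h₃ h0 ht).sub (hb.intervalIntegrable h₄ h0 ht)), hu]
    simp only
    rw [hb.sub_eq h₁ h₂ ht, hb.sub_eq h₃ h₄ ht, hg t ht]
    abel
  have hvb : ∀ t ∈ Icc 0 T, ‖v t‖ ≤ M * ‖u t‖ + N * (p * q) := by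
    intro t ht
    refine (hb.four_point t ht _ _ _ _).trans ?_
    gcongr
    · exact h₁₂ t ht
    · exact h₂₄ t ht
  have hub : ∀ t ∈ Icc 0 T, ‖u t‖ ≤ T * (N * (p * q)) * Real.exp (M * T) := by
    intro t ht
    simpa using norm_le_mul_exp_of_eq_add_integral (u := u) (g := 0) (v := v) le_rfl hM
      (by positivity : 0 ≤ N * (p * q)) ((h₁.continuousOn.sub h₂.continuousOn).sub
        (h₃.continuousOn.sub h₄.continuousOn)) (by simp) (by simpa using hueq) hvb t ht
  refine ⟨hub t ht, ?_⟩
  change ‖u t - u s‖ ≤ _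
  rw [hueq t ht, hueq s hs, intervalIntegral.integral_interval_sub_left (hint h0 ht) (hint h0 hs)]
  refine intervalIntegral.norm_integral_le_of_norm_le_const fun r hr => ?_
  have hr' : r ∈ Icc 0 T :=
    OrdConnected.uIcc_subset ordConnected_Icc hs ht (uIoc_subset_uIcc hr)
  refine (hvb r hr').trans ?_
  gcongr
  exact hub r hr'

end

end Trajectories

section Flows

open Filter Topology

variable {E : Type*} [NormedAddCommGroup E] [NormedSpace ℝ E] [MeasurableSpace E] [BorelSpace E]
  [SecondCountableTopology E] {b : ℝ → E → E} {T M N : ℝ} {X Y : ℝ → E} {Φ Ψ : ℝ → E → E}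

theorem IsRegularDrift.norm_flow_sub_le (hb : IsRegularDrift b T M N)
    (hΦ : ∀ x, IsTrajectory b T (fun t => x + X t) fun t => Φ t x) (x y : E) {t : ℝ}
    (ht : t ∈ Icc 0 T) : ‖Φ t x - Φ t y‖ ≤ ‖x - y‖ * Real.exp (M * T) :=
  hb.norm_sub_le (hΦ x) (hΦ y) (norm_nonneg _) (fun t _ => by simp) ht

theorem IsRegularDrift.differentiable_flow [CompleteSpace E] (hb : IsRegularDrift b T M N)
    (hΦ : ∀ x, IsTrajectory b T (fun t => x + X t) fun t => Φ t x) {t : ℝ} (ht : t ∈ Icc 0 T) :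
    Differentiable ℝ (Φ t) := by
  intro x
  have hex : ∃ A : E →L[ℝ] E, HasFDerivAt (fun y => Φ t (x + y) - Φ t x) A 0 := by
    refine exists_hasFDerivAt_zero_of_almost_additive
      (K := T * N * Real.exp (M * T) ^ 3) (L := Real.exp (M * T)) (fun y z => ?_) (fun y => ?_)
    · have h := (hb.norm_four_point_le (hΦ (x + y + z)) (hΦ (x + y)) (hΦ (x + z)) (hΦ x)
        (fun t _ => by abel) (p := ‖z‖ * Real.exp (M * T)) (q := ‖y‖ * Real.exp (M * T))
        (by positivity) (by positivity)
        (fun t ht => by simpa using hb.norm_flow_sub_le hΦ (x + y + z) (x + y) ht)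
        (fun t ht => by simpa using hb.norm_flow_sub_le hΦ (x + y) x ht) ht ht).1
      calc _ = ‖Φ t (x + y + z) - Φ t (x + y) - (Φ t (x + z) - Φ t x)‖ := by
            rw [add_assoc]
            congr 1
            abel
        _ ≤ _ := h
        _ = _ := by ring
    · rw [mul_comm]
      simpa using hb.norm_flow_sub_le hΦ (x + y) x ht
  obtain ⟨A, hA⟩ := hex
  have h := hA.add_const (Φ t x)
  simp only [sub_add_cancel] at h
  simpa using ((hasFDerivAt_comp_add_left x).1 h).differentiableAt

/-- Stability of the space derivative of the flow, in the supremum norm and in the Lipschitz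
seminorm in time, with respect to a uniform perturbation of the driving path. -/
theorem IsRegularDrift.norm_fderiv_flow_sub_le [CompleteSpace E] (hb : IsRegularDrift b T M N)
    (hΦ : ∀ x, IsTrajectory b T (fun t => x + X t) fun t => Φ t x)
    (hΨ : ∀ x, IsTrajectory b T (fun t => x + Y t) fun t => Ψ t x)
    {η : ℝ} (hη : 0 ≤ η) (hXY : ∀ t ∈ Icc 0 T, ‖X t - Y t‖ ≤ η) (x : E) {s t : ℝ}
    (hs : s ∈ Icc 0 T) (ht : t ∈ Icc 0 T) :
    ‖fderiv ℝ (Φ t) x - fderiv ℝ (Ψ t) x‖ ≤ N * Real.exp (M * T) ^ 2 * η * (T * Real.exp (M * T)) ∧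
    ‖(fderiv ℝ (Φ t) x - fderiv ℝ (Ψ t) x) - (fderiv ℝ (Φ s) x - fderiv ℝ (Ψ s) x)‖ ≤
      N * Real.exp (M * T) ^ 2 * η * (M * T * Real.exp (M * T) + 1) * |t - s| := by
  have hT : 0 ≤ T := ht.1.trans ht.2
  have hM := hb.nonneg_left
  have hN := hb.nonneg_right
  have key := fun z => hb.norm_four_point_le (hΦ z) (hΦ x) (hΨ z) (hΨ x)
    (fun t _ => by abel) (p := ‖z - x‖ * Real.exp (M * T)) (q := η * Real.exp (M * T))
    (by positivity) (by positivity) (fun t ht => hb.norm_flow_sub_le hΦ z x ht)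
    (fun t ht => hb.norm_sub_le (hΦ x) (hΨ x) hη (fun t ht => by simpa using hXY t ht) ht) hs ht
  have hd : ∀ {r : ℝ}, r ∈ Icc 0 T →
      HasFDerivAt (fun z => Φ r z - Ψ r z) (fderiv ℝ (Φ r) x - fderiv ℝ (Ψ r) x) x := fun hr =>
    (hb.differentiable_flow hΦ hr x).hasFDerivAt.sub (hb.differentiable_flow hΨ hr x).hasFDerivAt
  refine ⟨(hd ht).le_of_lip' (by positivity) (Eventually.of_forall fun z => ?_),
    ((hd ht).sub (hd hs)).le_of_lip' (by positivity) (Eventually.of_forall fun z => ?_)⟩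
  · calc _ = ‖Φ t z - Φ t x - (Ψ t z - Ψ t x)‖ := by
          congr 1
          abel
      _ ≤ _ := (key z).1
      _ = _ := by ring
  · calc _ = ‖Φ t z - Φ t x - (Ψ t z - Ψ t x) - (Φ s z - Φ s x - (Ψ s z - Ψ s x))‖ := by
          congr 1
          simp only [Pi.sub_apply]
          abel
      _ ≤ _ := (key z).2
      _ = _ := by ring

end Flows

/-- stability of the space derivative of the flow, second part of
Lemma `flow_convergence_X_smooth`. For `b ∈ L^∞([0,T];C²_b)` and `γ`-Hölder drivers
`X, Y` with `X 0 = Y 0 = 0`, the space derivatives `DΦ^X_t(x)`, `DΦ^Y_t(x)` exist and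
`sup_t ‖DΦ^X_t(x) - DΦ^Y_t(x)‖ + Lip-seminorm in t of the difference
  ≤ C(T, sup‖Db‖, sup‖D²b‖) ‖X - Y‖_γ`, with `C` nondecreasing in each argument. -/
theorem stmt2 (d : ℕ) (γ : ℝ) (hγ0 : 0 < γ) (hγ1 : γ ≤ 1) :
    ∃ C : ℝ → ℝ → ℝ → ℝ,
      (∀ T₁ T₂ M₁ M₂ N₁ N₂ : ℝ, T₁ ≤ T₂ → M₁ ≤ M₂ → N₁ ≤ N₂ →
        C T₁ M₁ N₁ ≤ C T₂ M₂ N₂) ∧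
      ∀ (T : ℝ), 0 < T → ∀ (CD CD2 : ℝ),
      ∀ (b : ℝ → Euc d → Euc d) (X Y : ℝ → Euc d) (ΦX ΦY : ℝ → Euc d → Euc d),
        Measurable (Function.uncurry b) →
        (∀ t ∈ Icc (0:ℝ) T, ContDiff ℝ 2 (b t)) →
        (∃ Cb : ℝ, ∀ t ∈ Icc (0:ℝ) T, ∀ x : Euc d, ‖b t x‖ ≤ Cb) →
        (∀ t ∈ Icc (0:ℝ) T, ∀ x : Euc d, ‖fderiv ℝ (b t) x‖ ≤ CD) →
        (∀ t ∈ Icc (0:ℝ) T, ∀ x : Euc d, ‖iteratedFDeriv ℝ 2 (b t) x‖ ≤ CD2) →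
        X 0 = 0 → Y 0 = 0 →
        (∃ CX : ℝ, ∀ s ∈ Icc (0:ℝ) T, ∀ t ∈ Icc (0:ℝ) T,
          ‖X t - X s‖ ≤ CX * |t - s| ^ γ) →
        (∃ CY : ℝ, ∀ s ∈ Icc (0:ℝ) T, ∀ t ∈ Icc (0:ℝ) T,
          ‖Y t - Y s‖ ≤ CY * |t - s| ^ γ) →
        (∀ x : Euc d, ContinuousOn (fun t => ΦX t x) (Icc (0:ℝ) T)) →
        (∀ x : Euc d, ∀ t ∈ Icc (0:ℝ) T,
          ΦX t x = x + (∫ r in (0:ℝ)..t, b r (ΦX r x)) + X t) →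
        (∀ x : Euc d, ContinuousOn (fun t => ΦY t x) (Icc (0:ℝ) T)) →
        (∀ x : Euc d, ∀ t ∈ Icc (0:ℝ) T,
          ΦY t x = x + (∫ r in (0:ℝ)..t, b r (ΦY r x)) + Y t) →
        (∀ t ∈ Icc (0:ℝ) T, ∀ x : Euc d,
          DifferentiableAt ℝ (ΦX t) x ∧ DifferentiableAt ℝ (ΦY t) x) ∧
        (∀ CXY : ℝ,
          (∀ s ∈ Icc (0:ℝ) T, ∀ t ∈ Icc (0:ℝ) T,
            ‖(X t - Y t) - (X s - Y s)‖ ≤ CXY * |t - s| ^ γ) →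
          ∀ x : Euc d, ∀ t₀ ∈ Icc (0:ℝ) T, ∀ s ∈ Icc (0:ℝ) T, ∀ t ∈ Icc (0:ℝ) T,
            s ≠ t →
            ‖fderiv ℝ (ΦX t₀) x - fderiv ℝ (ΦY t₀) x‖ +
              ‖(fderiv ℝ (ΦX t) x - fderiv ℝ (ΦY t) x) -
                (fderiv ℝ (ΦX s) x - fderiv ℝ (ΦY s) x)‖ / |t - s| ≤
              C T CD CD2 * CXY) := by
  refine ⟨fun T M N => max N 0 * Real.exp (max M 0 * max T 0) ^ 2 * max T 0 ^ γ *
    (max T 0 * Real.exp (max M 0 * max T 0) +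
      (max M 0 * max T 0 * Real.exp (max M 0 * max T 0) + 1)), ?_, ?_⟩
  · intro T₁ T₂ M₁ M₂ N₁ N₂ hT hM hN
    dsimp only
    gcongr
  intro T hT CD CD2 b X Y ΦX ΦY hb hb2 hbd hD hD2 hX0 hY0 _ _ hXc hXe hYc hYe
  have hdrift := isRegularDrift_of_contDiff hT.le hb hb2 hbd hD hD2
  have hΦ : ∀ x, IsTrajectory b T (fun t => x + X t) fun t => ΦX t x := fun x =>
    ⟨hXc x, fun t ht => by rw [hXe x t ht]; abel⟩
  have hΨ : ∀ x, IsTrajectory b T (fun t => x + Y t) fun t => ΦY t x := fun x =>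
    ⟨hYc x, fun t ht => by rw [hYe x t ht]; abel⟩
  refine ⟨fun t ht x => ⟨hdrift.differentiable_flow hΦ ht x, hdrift.differentiable_flow hΨ ht x⟩,
    fun CXY hXY x t₀ ht₀ s hs t ht hst => ?_⟩
  have h0 : (0 : ℝ) ∈ Icc 0 T := ⟨le_rfl, hT.le⟩
  have hC : 0 ≤ CXY := by
    have h := (norm_nonneg _).trans (hXY 0 h0 T ⟨hT.le, le_rfl⟩)
    rw [sub_zero, abs_of_pos hT] at h
    exact nonneg_of_mul_nonneg_left h (by positivity)
  have hη : ∀ t ∈ Icc 0 T, ‖X t - Y t‖ ≤ CXY * T ^ γ := by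
    intro t ht
    have h := hXY 0 h0 t ht
    rw [hX0, hY0, sub_zero, sub_zero, sub_zero, abs_of_nonneg ht.1] at h
    refine h.trans ?_
    gcongr
    · exact ht.1
    · exact ht.2
  have hη0 : 0 ≤ CXY * T ^ γ := by positivity
  have hsup := (hdrift.norm_fderiv_flow_sub_le hΦ hΨ hη0 hη x ht₀ ht₀).1
  have hlip := (hdrift.norm_fderiv_flow_sub_le hΦ hΨ hη0 hη x hs ht).2
  have hpos : 0 < |t - s| := abs_pos.2 (sub_ne_zero.2 hst.symm)
  dsimp only
  rw [max_eq_left hdrift.nonneg_left, max_eq_left hdrift.nonneg_right, max_eq_left hT.le]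
  refine (add_le_add hsup ((div_le_iff₀ hpos).2 hlip)).trans_eq ?_
  ring
end
end

section
/- Let γ ∈ (0,1], T > 0. Let b : [0,T] × ℝ^d → ℝ^d be measurable with ‖b‖_{∞;Lin} < ∞, let X ∈ C^γ([0,T];ℝ^d) with X_0 = 0, and let Φ be a flow for b and X such that for every t ∈ [0,T] the map Φ_t : ℝ^d → ℝ^d is a bijection. Then for every φ ∈ C_c^∞(ℝ^d;ℝ^m), every t ∈ [0,T] and every N ∈ ℕ, the function x ↦ (1+|x|)^N · φ(Φ_t(x)) is bounded on ℝ^d. -/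
open MeasureTheory Set Function

noncomputable section

/-- Backward integral form of Grönwall's inequality. -/
theorem le_mul_exp_of_le_add_mul_integral {f : ℝ → ℝ} {A C t : ℝ} (ht : 0 ≤ t) (hC : 0 ≤ C)
    (hf : ContinuousOn f (Icc 0 t))
    (h : ∀ r ∈ Icc 0 t, f r ≤ A + C * ∫ s in r..t, f s) :
    f 0 ≤ A * Real.exp (C * t) := by
  have hint : IntervalIntegrable f volume 0 t :=
    ContinuousOn.intervalIntegrable (by rwa [uIcc_of_le ht])
  let v : ℝ → ℝ := fun r => (A + C * ∫ s in r..t, f s) * Real.exp (C * r)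
  have hcont : ContinuousOn v (Icc 0 t) := by
    have hprim : ContinuousOn (fun r => ∫ s in r..t, f s) (Icc 0 t) := by
      have := intervalIntegral.continuousOn_primitive_interval_left
        (μ := volume) (f := f) (a := 0) (b := t)
        (by rw [uIcc_of_le ht]; exact hf.integrableOn_Icc)
      rwa [uIcc_of_le ht] at this
    exact (continuousOn_const.add (continuousOn_const.mul hprim)).mul (by fun_prop)
  have hderiv : ∀ r ∈ Ioo 0 t, HasDerivAt v
      ((C * -f r) * Real.exp (C * r) +
        (A + C * ∫ s in r..t, f s) * (Real.exp (C * r) * C)) r := by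
    intro r hr
    have hprim : HasDerivAt (fun r => ∫ s in r..t, f s) (-f r) r := by
      refine intervalIntegral.integral_hasDerivAt_left
        (hint.mono_set ?_) ?_ (hf.continuousAt (Icc_mem_nhds hr.1 hr.2))
      · rw [uIcc_of_le ht, uIcc_of_le hr.2.le]
        exact Icc_subset_Icc_left hr.1.le
      · exact (hf.mono Ioo_subset_Icc_self).stronglyMeasurableAtFilter isOpen_Ioo r hr
    have hexp : HasDerivAt (fun r => Real.exp (C * r)) (Real.exp (C * r) * C) r := by
      simpa using ((hasDerivAt_id r).const_mul C).exp
    exact ((hprim.const_mul C).const_add A).mul hexp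
  have hmono : MonotoneOn v (Icc 0 t) := by
    refine monotoneOn_of_deriv_nonneg (convex_Icc 0 t) hcont ?_ ?_
    · rw [interior_Icc]
      exact fun r hr => (hderiv r hr).differentiableAt.differentiableWithinAt
    · rw [interior_Icc]
      intro r hr
      rw [(hderiv r hr).deriv]
      have := mul_nonneg (mul_nonneg hC (Real.exp_pos (C * r)).le)
        (sub_nonneg.2 (h r (Ioo_subset_Icc_self hr)))
      linarith
  have hv := hmono (left_mem_Icc.2 ht) (right_mem_Icc.2 ht) ht
  simp only [v, mul_zero, Real.exp_zero, mul_one, intervalIntegral.integral_same, add_zero] at hv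
  exact (h 0 (left_mem_Icc.2 ht)).trans hv

/-- A linearly growing measurable field is integrable along a continuous path. -/
theorem intervalIntegrable_field_along_path {E : Type*} [NormedAddCommGroup E]
    [MeasurableSpace E] [BorelSpace E] [SecondCountableTopology E]
    {b : ℝ → E → E} (hbm : Measurable (Function.uncurry b)) {C T : ℝ} (hT : 0 ≤ T)
    (hb : ∀ t ∈ Icc (0 : ℝ) T, ∀ x, ‖b t x‖ ≤ C * (1 + ‖x‖))
    {y : ℝ → E} (hy : ContinuousOn y (Icc 0 T)) :
    IntervalIntegrable (fun r => b r (y r)) volume 0 T := by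
  rw [intervalIntegrable_iff_integrableOn_Icc_of_le hT]
  have hbound : IntegrableOn (fun r => C * (1 + ‖y r‖)) (Icc 0 T) :=
    (continuousOn_const.mul (continuousOn_const.add hy.norm)).integrableOn_Icc
  refine hbound.mono' ?_ ?_
  · have hym : AEMeasurable y (volume.restrict (Icc 0 T)) := hy.aemeasurable measurableSet_Icc
    exact (hbm.comp_aemeasurable (aemeasurable_id.prodMk hym)).aestronglyMeasurable
  · exact (ae_restrict_iff' measurableSet_Icc).2 (.of_forall fun r hr => hb r hr (y r))

/-- polynomial decay of `φ ∘ Φ_t`, Corollary `flot_schwarz`.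
For `b` of linear growth, a `γ`-Hölder driver `X` with `X 0 = 0`, and a flow `Φ`
whose time-`t` maps are bijections, for every `φ ∈ C_c^∞`, `t ∈ [0,T]` and `N ∈ ℕ`
the function `x ↦ (1+|x|)^N φ(Φ_t(x))` is bounded. -/
theorem stmt10 (d m : ℕ) (γ : ℝ) (hγ0 : 0 < γ) (hγ1 : γ ≤ 1)
    (T : ℝ) (hT : 0 < T)
    (b : ℝ → Euc d → Euc d) (hbm : Measurable (Function.uncurry b))
    (CLin : ℝ) (hb : ∀ t ∈ Icc (0:ℝ) T, ∀ x : Euc d, ‖b t x‖ ≤ CLin * (1 + ‖x‖))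
    (X : ℝ → Euc d) (hX0 : X 0 = 0)
    (hX : ∃ CX : ℝ, ∀ s ∈ Icc (0:ℝ) T, ∀ t ∈ Icc (0:ℝ) T,
      ‖X t - X s‖ ≤ CX * |t - s| ^ γ)
    (Φ : ℝ → Euc d → Euc d)
    (hΦc : ∀ x : Euc d, ContinuousOn (fun t => Φ t x) (Icc (0:ℝ) T))
    (hΦe : ∀ x : Euc d, ∀ t ∈ Icc (0:ℝ) T,
      Φ t x = x + (∫ r in (0:ℝ)..t, b r (Φ r x)) + X t)
    (hΦbij : ∀ t ∈ Icc (0:ℝ) T, Function.Bijective (Φ t))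
    (φ : Euc d → Euc m) (hφ : ContDiff ℝ (⊤ : ℕ∞) φ) (hφc : HasCompactSupport φ)
    (t : ℝ) (ht : t ∈ Icc (0:ℝ) T) (N : ℕ) :
    ∃ C : ℝ, ∀ x : Euc d, (1 + ‖x‖) ^ N * ‖φ (Φ t x)‖ ≤ C := by
  obtain ⟨CX, hCX⟩ := hX
  have hC : 0 ≤ CLin := by
    simpa using (norm_nonneg _).trans (hb 0 (left_mem_Icc.2 hT.le) 0)
  obtain ⟨R, hR⟩ := hφc.isCompact.isBounded.exists_norm_le
  obtain ⟨K, hK⟩ := hφ.continuous.bounded_above_of_compact_support hφc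
  let A := 1 + R + |CX| * T ^ γ
  let B := A * Real.exp (CLin * t)
  have hΦ0 : ∀ x, Φ 0 x = x := fun x => by
    simpa [hX0] using hΦe x 0 (left_mem_Icc.2 hT.le)
  have hpre : ∀ x, Φ t x ∈ tsupport φ → 1 + ‖x‖ ≤ B := by
    intro x hx
    have hint := intervalIntegrable_field_along_path hbm hT.le hb (hΦc x)
    have hsub : Icc 0 t ⊆ Icc 0 T := Icc_subset_Icc_right ht.2
    have hcont : ContinuousOn (fun r => 1 + ‖Φ r x‖) (Icc 0 t) :=
      continuousOn_const.add ((hΦc x).mono hsub).norm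
    have key := le_mul_exp_of_le_add_mul_integral (A := A) ht.1 hC hcont ?_
    · simpa only [hΦ0] using key
    intro r hr
    have hintr : ∀ s ∈ Icc (0 : ℝ) T,
        IntervalIntegrable (fun r => b r (Φ r x)) volume 0 s := fun s hs =>
      hint.mono_set (by
        rw [uIcc_of_le hT.le, uIcc_of_le hs.1]
        exact Icc_subset_Icc_right hs.2)
    have heq : Φ r x = Φ t x - (∫ s in r..t, b s (Φ s x)) + (X r - X t) := by
      rw [hΦe x r (hsub hr), hΦe x t ht,
        ← intervalIntegral.integral_add_adjacent_intervals (hintr r (hsub hr))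
          ((hintr r (hsub hr)).symm.trans (hintr t ht))]
      abel
    have hXle : ‖X r - X t‖ ≤ |CX| * T ^ γ := by
      refine (hCX t ht r (hsub hr)).trans ?_
      have hrt : |r - t| ≤ T := abs_le.2 ⟨by linarith [hr.1, ht.2], by linarith [hr.2]⟩
      exact mul_le_mul (le_abs_self CX)
        (Real.rpow_le_rpow (abs_nonneg _) hrt hγ0.le) (by positivity) (abs_nonneg _)
    have hIle : ‖∫ s in r..t, b s (Φ s x)‖ ≤ CLin * ∫ s in r..t, (1 + ‖Φ s x‖) := by
      rw [← intervalIntegral.integral_const_mul]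
      refine intervalIntegral.norm_integral_le_of_norm_le hr.2 ?_ ?_
      · exact .of_forall fun s hs => hb s ⟨hr.1.trans hs.1.le, hs.2.trans ht.2⟩ _
      · refine ContinuousOn.intervalIntegrable ?_
        rw [uIcc_of_le hr.2]
        exact continuousOn_const.mul (hcont.mono (Icc_subset_Icc_left hr.1))
    have hnorm : ‖Φ r x‖ ≤ ‖Φ t x‖ + ‖∫ s in r..t, b s (Φ s x)‖ + ‖X r - X t‖ := by
      conv_lhs => rw [heq]
      exact (norm_add_le _ _).trans (by gcongr; exact norm_sub_le _ _)
    have := hR _ hx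
    simp only [A]
    linarith
  refine ⟨|B| ^ N * |K|, fun x => ?_⟩
  by_cases hx : Φ t x ∈ tsupport φ
  · gcongr
    · exact (hpre x hx).trans (le_abs_self B)
    · exact (hK _).trans (le_abs_self K)
  · rw [image_eq_zero_of_notMem_tsupport hx, norm_zero, mul_zero]
    positivity
end
end

section
/- Let 1/3 < γ ≤ 1/2, T > 0. Let b : [0,T] × ℝ^d → ℝ^d be measurable with ‖b‖_{∞;Lin} < ∞, such that each b_t is C^1 and ‖div b‖_∞ := sup_{t,x} |div b_t(x)| < ∞; let X ∈ C^γ([0,T];ℝ^d) with X_0 = 0, and let Φ be a flow for b and X such that each Φ_t is a C^1-diffeomorphism of ℝ^d whose Jacobian determinant satisfies det DΦ_t(x) = exp(∫_0^t div b_q(Φ_q(x)) dq). Let u_0 ∈ L^∞(ℝ^d) and set u(t,x) := u_0(Φ_t^{-1}(x)). Then for every φ ∈ C_c^∞(ℝ^d;ℝ), the path t ↦ u_t(∇φ) := ∫_{ℝ^d} u(t,x) ∇φ(x) dx is controlled by X, and there is a constant C_D(φ), depending only on γ, φ, T, ‖b‖_{∞;Lin} and ‖div b‖_∞, and nondecreasing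 in the last three, such that ‖u(∇φ)‖_{D^γ_X} ≤ C_D(φ) ‖u_0‖_∞ (1 + ‖X‖_γ)^{1+1/γ}. -/
open MeasureTheory Set Function

noncomputable section

open Filter Topology

/-- Grönwall's inequality in integral form on the unit interval. -/
lemma le_mul_exp_of_le_add_mul_integral_s12 {W : ℝ → ℝ} {A k : ℝ} (hW : Continuous W)
    (hW0 : ∀ θ, 0 ≤ W θ) (hA : 0 ≤ A) (hk : 0 ≤ k)
    (h : ∀ θ ∈ Icc (0 : ℝ) 1, W θ ≤ A + k * ∫ x in (0 : ℝ)..θ, W x) :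
    ∀ θ ∈ Icc (0 : ℝ) 1, W θ ≤ A * Real.exp (k * θ) := by
  intro θ hθ
  have hd : ∀ x, HasDerivAt (fun θ => A + k * ∫ x in (0 : ℝ)..θ, W x) (k * W x) x := fun x =>
    ((intervalIntegral.integral_hasDerivAt_right (hW.intervalIntegrable _ _)
      hW.aestronglyMeasurable.stronglyMeasurableAtFilter hW.continuousAt).const_mul k).const_add A
  have h2 := norm_le_gronwallBound_of_norm_deriv_right_le (K := k) (ε := 0) (δ := A)
    (f := fun θ => A + k * ∫ x in (0 : ℝ)..θ, W x) (f' := fun x => k * W x) (a := 0) (b := 1)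
    (fun x _ => (hd x).continuousAt.continuousWithinAt)
    (fun x _ => (hd x).hasDerivWithinAt) (by simp [abs_of_nonneg hA])
    (fun x hx => by
      rw [Real.norm_of_nonneg (mul_nonneg hk (hW0 x)), add_zero]
      gcongr
      exact (h x ⟨hx.1, hx.2.le⟩).trans (Real.le_norm_self _)) θ hθ
  rw [gronwallBound_ε0, sub_zero] at h2
  exact (h θ hθ).trans ((Real.le_norm_self _).trans h2)

/-- A path driven by a drift of linear growth and a Hölder perturbation which visits the ball of
radius `R` stays bounded on `[0, T]`, forwards and backwards in time. -/
lemma one_add_norm_le_of_linear_growth {E : Type*} [NormedAddCommGroup E] [NormedSpace ℝ E]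
    {T M CX γ R : ℝ} {c β X : ℝ → E} (hT : 0 ≤ T) (hM : 0 ≤ M) (hCX : 0 ≤ CX) (hγ : 0 ≤ γ)
    (hc : ContinuousOn c (Icc 0 T)) (hβ : ∀ r ∈ Icc 0 T, ‖β r‖ ≤ M * (1 + ‖c r‖))
    (hX : ∀ s ∈ Icc 0 T, ∀ t ∈ Icc 0 T, ‖X t - X s‖ ≤ CX * |t - s| ^ γ)
    (heq : ∀ s ∈ Icc 0 T, ∀ t ∈ Icc 0 T, c t - c s = (∫ r in s..t, β r) + (X t - X s))
    {s t : ℝ} (hs : s ∈ Icc 0 T) (ht : t ∈ Icc 0 T) (hR : ‖c s‖ ≤ R) :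
    1 + ‖c t‖ ≤ (1 + R + CX * T ^ γ) * Real.exp (M * T) := by
  have hR0 : 0 ≤ R := (norm_nonneg _).trans hR
  set e : ℝ → E := IccExtend hT ((Icc 0 T).domRestrict c) with he
  have hec : Continuous e := (continuousOn_iff_continuous_domRestrict.1 hc).Icc_extend'
  have hee : ∀ r ∈ Icc 0 T, e r = c r := fun r hr => by
    rw [he, IccExtend_of_mem hT _ hr]; rfl
  have hmem : ∀ θ ∈ Icc (0 : ℝ) 1, s + (t - s) * θ ∈ Icc 0 T := fun θ hθ => by
    have := (convex_Icc (0 : ℝ) T).add_smul_sub_mem hs ht hθ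
    simpa [mul_comm] using this
  have hts : |t - s| ≤ T := by
    rw [abs_le]; constructor <;> linarith [hs.1, hs.2, ht.1, ht.2]
  have hA : 0 ≤ 1 + R + CX * T ^ γ := by positivity
  have key := le_mul_exp_of_le_add_mul_integral_s12 (W := fun θ => 1 + ‖e (s + (t - s) * θ)‖)
    (A := 1 + R + CX * T ^ γ) (k := M * |t - s|) (by fun_prop) (fun θ => by positivity) hA
    (by positivity) (fun θ hθ => by
      have hr := hmem θ hθ
      set r := s + (t - s) * θ with hrdef
      have h1 : c r = c s + (∫ r in s..r, β r) + (X r - X s) := by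
        rw [add_assoc, ← heq s hs r hr]; abel
      have h2 : ‖X r - X s‖ ≤ CX * T ^ γ := by
        refine (hX s hs r hr).trans ?_
        gcongr
        rw [abs_le]; constructor <;> linarith [hs.1, hs.2, hr.1, hr.2]
      have h3 : ‖∫ r in s..r, β r‖ ≤ |∫ x in s..r, M * (1 + ‖e x‖)| := by
        refine intervalIntegral.norm_integral_le_abs_of_norm_le
          (ae_restrict_of_forall_mem measurableSet_uIoc fun x hx => ?_)
          (Continuous.intervalIntegrable (by fun_prop) _ _)
        have hx' : x ∈ Icc 0 T := by
          have := uIoc_subset_uIcc hx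
          exact (convex_Icc (0 : ℝ) T).ordConnected.uIcc_subset hs hr this
        rw [hee x hx']
        exact hβ x hx'
      have h4 : ∫ x in s..r, M * (1 + ‖e x‖) =
          (t - s) * (M * ∫ x in (0 : ℝ)..θ, (1 + ‖e (s + (t - s) * x)‖)) := by
        have := intervalIntegral.smul_integral_comp_add_mul (a := 0) (b := θ)
          (fun x => 1 + ‖e x‖) (t - s) s
        rw [mul_zero, add_zero, ← hrdef] at this
        rw [intervalIntegral.integral_const_mul, ← this, smul_eq_mul]
        ring
      have h5 : 0 ≤ ∫ x in (0 : ℝ)..θ, (1 + ‖e (s + (t - s) * x)‖) :=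
        intervalIntegral.integral_nonneg hθ.1 fun x _ => by positivity
      rw [h4, abs_mul, abs_of_nonneg (mul_nonneg hM h5)] at h3
      have h6 : ‖c r‖ ≤ ‖c s‖ + ‖∫ r in s..r, β r‖ + ‖X r - X s‖ := by
        rw [h1]; exact norm_add₃_le
      simp only [hee r hr]
      linarith) 1 (by simp)
  rw [mul_one, mul_one, add_sub_cancel, hee t ht] at key
  refine key.trans ?_
  gcongr

/-- Bound for the drift of a path over `[s, t]`, when the path is in the ball of radius
`R` at one of the two times. -/
lemma norm_integral_drift_le {E : Type*} [NormedAddCommGroup E] [NormedSpace ℝ E]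
    {T M CX γ R : ℝ} {c β X : ℝ → E} (hM : 0 ≤ M) (hCX : 0 ≤ CX) (hγ : 0 ≤ γ) (hγ1 : γ ≤ 1)
    (hc : ContinuousOn c (Icc 0 T)) (hβ : ∀ r ∈ Icc 0 T, ‖β r‖ ≤ M * (1 + ‖c r‖))
    (hX : ∀ s ∈ Icc 0 T, ∀ t ∈ Icc 0 T, ‖X t - X s‖ ≤ CX * |t - s| ^ γ)
    (heq : ∀ s ∈ Icc 0 T, ∀ t ∈ Icc 0 T, c t - c s = (∫ r in s..t, β r) + (X t - X s))
    {s t : ℝ} (hs : s ∈ Icc 0 T) (ht : t ∈ Icc 0 T) (hR : ‖c s‖ ≤ R ∨ ‖c t‖ ≤ R) :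
    ‖∫ r in s..t, β r‖ ≤ M * ((1 + R) * (1 + T) * Real.exp (M * T)) * (1 + CX) * |t - s| := by
  have hT : 0 ≤ T := hs.1.trans hs.2
  have hR0 : 0 ≤ R := by rcases hR with h | h <;> exact (norm_nonneg _).trans h
  have hTγ : T ^ γ ≤ 1 + T := by
    calc T ^ γ ≤ (1 + T) ^ γ := by gcongr; linarith
      _ ≤ (1 + T) ^ (1 : ℝ) := Real.rpow_le_rpow_of_exponent_le (by linarith) hγ1
      _ = 1 + T := Real.rpow_one _
  have hb : ∀ r ∈ Icc 0 T, 1 + ‖c r‖ ≤ (1 + R) * (1 + T) * Real.exp (M * T) * (1 + CX) := by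
    intro r hr
    have : 1 + ‖c r‖ ≤ (1 + R + CX * T ^ γ) * Real.exp (M * T) := by
      rcases hR with h | h
      · exact one_add_norm_le_of_linear_growth hT hM hCX hγ hc hβ hX heq hs hr h
      · exact one_add_norm_le_of_linear_growth hT hM hCX hγ hc hβ hX heq ht hr h
    refine this.trans ?_
    have h2 : 1 + R + CX * T ^ γ ≤ (1 + R) * (1 + T) * (1 + CX) := by
      have : CX * T ^ γ ≤ CX * (1 + T) := by gcongr
      have h3 : 0 ≤ R * CX := by positivity
      have h4 : 0 ≤ R * T := by positivity
      have h5 : 0 ≤ R * T * CX := by positivity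
      nlinarith
    calc _ ≤ (1 + R) * (1 + T) * (1 + CX) * Real.exp (M * T) := by gcongr
      _ = _ := by ring
  refine intervalIntegral.norm_integral_le_of_norm_le_const fun r hr => ?_
  have hr' : r ∈ Icc 0 T :=
    (convex_Icc (0 : ℝ) T).ordConnected.uIcc_subset hs ht (uIoc_subset_uIcc hr)
  calc _ ≤ M * (1 + ‖c r‖) := hβ r hr'
    _ ≤ M * ((1 + R) * (1 + T) * Real.exp (M * T) * (1 + CX)) := by gcongr; exact hb r hr'
    _ = _ := by ring

/-- On `[0, T]` a power with smaller exponent dominates up to the factor `1 + T`. -/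
lemma le_one_add_mul_rpow {T δ α : ℝ} (hδ : 0 ≤ δ) (hδT : δ ≤ T) (hα0 : 0 ≤ α) (hα : α ≤ 1) :
    δ ≤ (1 + T) * δ ^ α := by
  rcases hδ.eq_or_lt with rfl | h
  · have := Real.rpow_nonneg (le_refl (0 : ℝ)) α
    positivity
  · calc δ = δ ^ (1 - α) * δ ^ α := by rw [← Real.rpow_add h]; simp
      _ ≤ (1 + T) ^ (1 : ℝ) * δ ^ α := by
        gcongr
        calc δ ^ (1 - α) ≤ (1 + T) ^ (1 - α) := by
              gcongr
              linarith
          _ ≤ _ := Real.rpow_le_rpow_of_exponent_le (by linarith) (by linarith)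
      _ = _ := by rw [Real.rpow_one]

lemma abs_exp_sub_exp_le (a b : ℝ) :
    |Real.exp b - Real.exp a| ≤ Real.exp a * (|b - a| * Real.exp |b - a|) := by
  have h : Real.exp b - Real.exp a = Real.exp a * (Real.exp (b - a) - 1) := by
    rw [mul_sub, ← Real.exp_add]; simp
  rw [h, abs_mul, abs_of_pos (Real.exp_pos a)]
  gcongr
  generalize b - a = x
  have h1 := Real.add_one_le_exp x
  have h2 := Real.add_one_le_exp (-x)
  have h3 := Real.exp_pos x
  have h4 : Real.exp (-x) * Real.exp x = 1 := by rw [← Real.exp_add]; simp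
  have h5 : 1 ≤ Real.exp |x| := Real.one_le_exp (abs_nonneg x)
  have h6 : Real.exp x ≤ Real.exp |x| := Real.exp_le_exp.2 (le_abs_self x)
  rw [abs_le]
  constructor
  · nlinarith [neg_abs_le x, abs_nonneg x]
  · have : Real.exp x - 1 ≤ x * Real.exp x := by nlinarith
    refine this.trans ?_
    calc x * Real.exp x ≤ |x| * Real.exp x := by gcongr; exact le_abs_self x
      _ ≤ _ := by gcongr

/-- First order Taylor estimate for a function with Lipschitz derivative. -/
lemma norm_sub_sub_fderiv_le {E F : Type*} [NormedAddCommGroup E] [NormedSpace ℝ E]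
    [NormedAddCommGroup F] [NormedSpace ℝ F] {g : E → F} {Λ : ℝ} (hΛ : 0 ≤ Λ)
    (hg : Differentiable ℝ g) (hL : ∀ x y, ‖fderiv ℝ g y - fderiv ℝ g x‖ ≤ Λ * ‖y - x‖) (x y : E) :
    ‖g y - g x - fderiv ℝ g x (y - x)‖ ≤ Λ * ‖y - x‖ ^ 2 := by
  have h := Convex.norm_image_sub_le_of_norm_fderiv_le' (𝕜 := ℝ) (f := g) (φ := fderiv ℝ g x)
    (s := Metric.closedBall x ‖y - x‖) (C := Λ * ‖y - x‖) (fun z _ => hg z)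
    (fun z hz => (hL x z).trans (by
      gcongr
      simpa [dist_eq_norm] using hz)) (convex_closedBall _ _)
    (Metric.mem_closedBall_self (norm_nonneg _)) (by simp [dist_eq_norm] : y ∈ _)
  calc _ ≤ Λ * ‖y - x‖ * ‖y - x‖ := h
    _ = _ := by ring

lemma aestronglyMeasurable_uncurry_comp {E F : Type*} [TopologicalSpace E]
    [TopologicalSpace.PseudoMetrizableSpace E] [MeasurableSpace E] [BorelSpace E]
    [TopologicalSpace F] [TopologicalSpace.PseudoMetrizableSpace F] [MeasurableSpace F]
    [OpensMeasurableSpace F] [SecondCountableTopology F]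
    {b : ℝ → E → F} (hb : Measurable (uncurry b))
    {c : ℝ → E} {S : Set ℝ} (hS : MeasurableSet S) (hc : ContinuousOn c S) :
    AEStronglyMeasurable (fun r => b r (c r)) (volume.restrict S) :=
  (hb.comp_aemeasurable (aemeasurable_id.prodMk (hc.aemeasurable hS))).aestronglyMeasurable

lemma aestronglyMeasurable_fderiv_comp_apply {E F : Type*} [NormedAddCommGroup E]
    [NormedSpace ℝ E] [MeasurableSpace E] [BorelSpace E] [NormedAddCommGroup F] [NormedSpace ℝ F]
    [MeasurableSpace F] [BorelSpace F] [SecondCountableTopology F]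
    {b : ℝ → E → F} (hb : Measurable (uncurry b))
    {c : ℝ → E} {S : Set ℝ} (hS : MeasurableSet S) (hc : ContinuousOn c S)
    (hd : ∀ r ∈ S, Differentiable ℝ (b r)) (v : E) :
    AEStronglyMeasurable (fun r => fderiv ℝ (b r) (c r) v) (volume.restrict S) := by
  refine aestronglyMeasurable_of_tendsto_ae atTop
    (f := fun (n : ℕ) r => (n : ℝ) • (b r (c r + (n : ℝ)⁻¹ • v) - b r (c r))) (fun n => ?_)
    (ae_restrict_of_forall_mem hS fun r hr => ?_)
  · exact ((aestronglyMeasurable_uncurry_comp hb hS (hc.add continuousOn_const)).sub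
      (aestronglyMeasurable_uncurry_comp hb hS hc)).const_smul _
  · exact (hd r hr (c r)).hasFDerivAt.lim v (by simpa using tendsto_natCast_atTop_atTop)

lemma aestronglyMeasurable_trace_fderiv_comp {E : Type*} [NormedAddCommGroup E]
    [InnerProductSpace ℝ E] [FiniteDimensional ℝ E] [MeasurableSpace E] [BorelSpace E]
    {b : ℝ → E → E} (hb : Measurable (uncurry b))
    {c : ℝ → E} {S : Set ℝ} (hS : MeasurableSet S) (hc : ContinuousOn c S)
    (hd : ∀ r ∈ S, Differentiable ℝ (b r)) :
    AEStronglyMeasurable (fun r => LinearMap.trace ℝ E (fderiv ℝ (b r) (c r)).toLinearMap)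
      (volume.restrict S) := by
  simp_rw [LinearMap.trace_eq_sum_inner _ (stdOrthonormalBasis ℝ E)]
  refine Finset.aestronglyMeasurable_fun_sum _ fun i _ => ?_
  exact aestronglyMeasurable_const.inner (aestronglyMeasurable_fderiv_comp_apply hb hS hc hd _)

section ChangeOfVariables

variable {E F : Type*} [NormedAddCommGroup E] [NormedSpace ℝ E] [FiniteDimensional ℝ E]
  [MeasurableSpace E] [BorelSpace E] [NormedAddCommGroup F] [NormedSpace ℝ F]
  {μ : Measure E} [μ.IsAddHaarMeasure] {Φ : E → E} {J : E → ℝ}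

lemma integrable_smul_comp_of_det_fderiv_eq (hΦ : Differentiable ℝ Φ) (hbij : Bijective Φ)
    (hJ : ∀ y, LinearMap.det (fderiv ℝ Φ y).toLinearMap = J y) (hJ0 : ∀ y, 0 ≤ J y) {f : E → F}
    (hf : Integrable f μ) : Integrable (fun y => J y • f (Φ y)) μ := by
  have h := integrableOn_image_iff_integrableOn_abs_det_fderiv_smul μ MeasurableSet.univ
    (fun x _ => (hΦ x).hasFDerivAt.hasFDerivWithinAt) hbij.1.injOn f
  simp only [image_univ, hbij.2.range_eq, integrableOn_univ, ContinuousLinearMap.det, hJ,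
    abs_of_nonneg (hJ0 _)] at h
  exact h.1 hf

lemma integral_eq_integral_smul_comp_of_det_fderiv_eq (hΦ : Differentiable ℝ Φ)
    (hbij : Bijective Φ) (hJ : ∀ y, LinearMap.det (fderiv ℝ Φ y).toLinearMap = J y)
    (hJ0 : ∀ y, 0 ≤ J y) (f : E → F) : ∫ x, f x ∂μ = ∫ y, J y • f (Φ y) ∂μ := by
  have h := integral_image_eq_integral_abs_det_fderiv_smul μ MeasurableSet.univ
    (fun x _ => (hΦ x).hasFDerivAt.hasFDerivWithinAt) hbij.1.injOn f
  simpa only [image_univ, hbij.2.range_eq, Measure.restrict_univ, ContinuousLinearMap.det, hJ,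
    abs_of_nonneg (hJ0 _)] using h

/-- A weighted difference bound for integrals against a bounded function, where the weights are
the pullbacks of the indicator of `K` under two changes of variables. -/
lemma norm_integral_smul_le_of_norm_le_weights {Φ' : E → E} {J' : E → ℝ} {K : Set E}
    (hK : MeasurableSet K) (hKfin : μ K ≠ ⊤)
    (hΦ : Differentiable ℝ Φ) (hbij : Bijective Φ)
    (hJ : ∀ y, LinearMap.det (fderiv ℝ Φ y).toLinearMap = J y) (hJ0 : ∀ y, 0 ≤ J y)
    (hΦ' : Differentiable ℝ Φ') (hbij' : Bijective Φ')
    (hJ' : ∀ y, LinearMap.det (fderiv ℝ Φ' y).toLinearMap = J' y) (hJ0' : ∀ y, 0 ≤ J' y)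
    {u : E → ℝ} {C₀ a : ℝ} (ha : 0 ≤ a) (hu : ∀ y, |u y| ≤ C₀) {G : E → F}
    (hG : ∀ y, Φ y ∈ K ∨ Φ' y ∈ K → ‖G y‖ ≤ a * J y ∧ ‖G y‖ ≤ a * J' y)
    (hG0 : ∀ y, Φ y ∉ K → Φ' y ∉ K → G y = 0) :
    ‖∫ y, u y • G y ∂μ‖ ≤ C₀ * (a * (2 * μ.real K)) := by
  set w : E → ℝ := K.indicator 1 with hw
  have hwi : Integrable w μ := (integrable_indicator_iff hK).2 (integrableOn_const hKfin)
  have hw0 : ∀ x, 0 ≤ w x := fun x => indicator_nonneg (by simp) x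
  have hwv : ∫ x, w x ∂μ = μ.real K := by rw [hw, integral_indicator_one hK]
  have hC₀ : 0 ≤ C₀ := (abs_nonneg _).trans (hu 0)
  have h1 := integrable_smul_comp_of_det_fderiv_eq hΦ hbij hJ hJ0 hwi
  have h2 := integrable_smul_comp_of_det_fderiv_eq hΦ' hbij' hJ' hJ0' hwi
  calc ‖∫ y, u y • G y ∂μ‖
      ≤ ∫ y, C₀ * (a * (J y • w (Φ y) + J' y • w (Φ' y))) ∂μ := by
        refine norm_integral_le_of_norm_le (((h1.add h2).const_mul a).const_mul C₀)
          (ae_of_all _ fun y => ?_)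
        rw [norm_smul]
        have hp : 0 ≤ J y • w (Φ y) := mul_nonneg (hJ0 y) (hw0 _)
        have hp' : 0 ≤ J' y • w (Φ' y) := mul_nonneg (hJ0' y) (hw0 _)
        refine mul_le_mul (hu y) ?_ (norm_nonneg _) hC₀
        by_cases hy : Φ y ∈ K
        · refine (hG y (Or.inl hy)).1.trans ?_
          gcongr
          rw [hw, indicator_of_mem hy] at hp ⊢
          simpa using hp'
        by_cases hy' : Φ' y ∈ K
        · refine (hG y (Or.inr hy')).2.trans ?_
          gcongr
          rw [hw, indicator_of_mem hy'] at hp' ⊢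
          simpa using hp
        · rw [hG0 y hy hy', norm_zero]
          exact mul_nonneg ha (add_nonneg hp hp')
    _ = C₀ * (a * (2 * μ.real K)) := by
        rw [integral_const_mul, integral_const_mul, integral_add h1 h2,
          ← integral_eq_integral_smul_comp_of_det_fderiv_eq hΦ hbij hJ hJ0,
          ← integral_eq_integral_smul_comp_of_det_fderiv_eq hΦ' hbij' hJ' hJ0', hwv]
        ring

end ChangeOfVariables

lemma norm_smul_sub_smul_le {E F : Type*} [SeminormedAddCommGroup E] [NormedAddCommGroup F]
    [NormedSpace ℝ F] {g : E → F} {Λ : ℝ} {p q : E} {j j' : ℝ} (hj : 0 ≤ j)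
    (hg : ∀ x, ‖g x‖ ≤ Λ) (hL : ∀ x y, ‖g y - g x‖ ≤ Λ * ‖y - x‖) :
    ‖j' • g q - j • g p‖ ≤ j * (Λ * ‖q - p‖) + |j' - j| * Λ := by
  have h : j' • g q - j • g p = j • (g q - g p) + (j' - j) • g q := by module
  rw [h]
  refine (norm_add_le _ _).trans ?_
  rw [norm_smul, norm_smul, Real.norm_of_nonneg hj, Real.norm_eq_abs]
  gcongr
  · exact hL _ _
  · exact hg _

lemma norm_smul_sub_smul_sub_fderiv_le {E F : Type*} [NormedAddCommGroup E] [NormedSpace ℝ E]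
    [NormedAddCommGroup F] [NormedSpace ℝ F] {g : E → F} {Λ : ℝ} {p q D ξ : E} {j j' : ℝ}
    (hj : 0 ≤ j) (hΛ : 0 ≤ Λ)
    (hd : Differentiable ℝ g) (hg : ∀ x, ‖g x‖ ≤ Λ) (hH : ∀ x, ‖fderiv ℝ g x‖ ≤ Λ)
    (hL : ∀ x y, ‖fderiv ℝ g y - fderiv ℝ g x‖ ≤ Λ * ‖y - x‖) (hpq : q - p = D + ξ) :
    ‖j' • g q - j • g p - j • fderiv ℝ g p ξ‖ ≤
      j * (Λ * ‖q - p‖ ^ 2) + j * (Λ * ‖D‖) + |j' - j| * Λ := by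
  have h : j' • g q - j • g p - j • fderiv ℝ g p ξ =
      j • (g q - g p - fderiv ℝ g p (q - p)) + j • fderiv ℝ g p D + (j' - j) • g q := by
    rw [hpq, map_add]; module
  rw [h]
  refine norm_add₃_le.trans ?_
  rw [norm_smul, norm_smul, norm_smul, Real.norm_of_nonneg hj, Real.norm_eq_abs]
  gcongr
  · exact norm_sub_sub_fderiv_le hΛ hd hL _ _
  · exact (fderiv ℝ g p).le_of_opNorm_le (hH p) D
  · exact hg _

/-- Bound for the increments of a path visiting the ball of radius `R`. -/
def driftConst (R T M : ℝ) : ℝ := (1 + M) * ((1 + R) * (1 + T) * Real.exp (M * T)) * (1 + T)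

/-- Bound for the relative increments of the Jacobian. -/
def jacobianConst (T N : ℝ) : ℝ := (1 + T) * (N * Real.exp (N * T))

/-- The constant in the controlled norm of the pairing with a test function. -/
def controlConst (R V Λ T M N : ℝ) : ℝ :=
  Real.exp (N * T) * (Λ * (driftConst R T M ^ 2 + driftConst R T M + jacobianConst T N)) * (2 * V)

lemma one_le_driftConst {R T M : ℝ} (hR : 0 ≤ R) (hT : 0 ≤ T) (hM : 0 ≤ M) :
    1 ≤ driftConst R T M := by
  have h : 1 ≤ Real.exp (M * T) := Real.one_le_exp (by positivity)
  unfold driftConst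
  refine one_le_mul_of_one_le_of_one_le (one_le_mul_of_one_le_of_one_le (by linarith)
    (one_le_mul_of_one_le_of_one_le (one_le_mul_of_one_le_of_one_le (by linarith) (by linarith))
    h)) (by linarith)

lemma controlConst_mono {R V Λ : ℝ} (hR : 0 ≤ R) (hV : 0 ≤ V) (hΛ : 0 ≤ Λ)
    {T₁ T₂ M₁ M₂ N₁ N₂ : ℝ} (hT₁ : 0 ≤ T₁) (hM₁ : 0 ≤ M₁) (hN₁ : 0 ≤ N₁)
    (hT : T₁ ≤ T₂) (hM : M₁ ≤ M₂) (hN : N₁ ≤ N₂) :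
    controlConst R V Λ T₁ M₁ N₁ ≤ controlConst R V Λ T₂ M₂ N₂ := by
  have hT₂ := hT₁.trans hT
  have hM₂ := hM₁.trans hM
  have hN₂ := hN₁.trans hN
  unfold controlConst driftConst jacobianConst
  gcongr

lemma abs_sub_le_of_mem_Icc {T s t : ℝ} (hs : s ∈ Icc 0 T) (ht : t ∈ Icc 0 T) : |t - s| ≤ T := by
  rw [abs_le]; constructor <;> linarith [hs.1, hs.2, ht.1, ht.2]

lemma integral_sub_integral_of_integrableOn_Icc {F : Type*} [NormedAddCommGroup F]
    [NormedSpace ℝ F] {T s t : ℝ} {f : ℝ → F}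
    (hf : IntegrableOn f (Icc 0 T)) (hs : s ∈ Icc 0 T) (ht : t ∈ Icc 0 T) :
    (∫ r in (0 : ℝ)..t, f r) - ∫ r in (0 : ℝ)..s, f r = ∫ r in s..t, f r := by
  have h0 : (0 : ℝ) ∈ Icc 0 T := ⟨le_rfl, hs.1.trans hs.2⟩
  have h : ∀ r ∈ Icc 0 T, IntervalIntegrable f volume 0 r := fun r hr =>
    (hf.mono_set ((convex_Icc (0 : ℝ) T).ordConnected.uIcc_subset h0 hr)).intervalIntegrable
  exact intervalIntegral.integral_interval_sub_left (h t ht) (h s hs)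

section Flow

variable {E : Type*} [NormedAddCommGroup E] [InnerProductSpace ℝ E] [FiniteDimensional ℝ E]
  [MeasurableSpace E] [BorelSpace E] {T CLin Cdiv CX γ R : ℝ} {b : ℝ → E → E} {c X : ℝ → E}

lemma sub_eq_integral_add_sub_of_flow (hb : Measurable (uncurry b))
    (hlin : ∀ t ∈ Icc (0 : ℝ) T, ∀ x, ‖b t x‖ ≤ CLin * (1 + ‖x‖))
    (hc : ContinuousOn c (Icc 0 T)) {x : E}
    (hflow : ∀ t ∈ Icc (0 : ℝ) T, c t = x + (∫ r in (0 : ℝ)..t, b r (c r)) + X t)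
    {s t : ℝ} (hs : s ∈ Icc 0 T) (ht : t ∈ Icc 0 T) :
    c t - c s = (∫ r in s..t, b r (c r)) + (X t - X s) := by
  have hi : IntegrableOn (fun r => b r (c r)) (Icc 0 T) :=
    Integrable.mono' (g := fun r => CLin * (1 + ‖c r‖))
      (ContinuousOn.integrableOn_compact isCompact_Icc (by fun_prop))
      (aestronglyMeasurable_uncurry_comp hb measurableSet_Icc hc)
      (ae_restrict_of_forall_mem measurableSet_Icc fun r hr => hlin r hr _)
  rw [← integral_sub_integral_of_integrableOn_Icc hi hs ht, hflow t ht, hflow s hs]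
  abel

lemma norm_drift_le_and_norm_increment_le (hb : Measurable (uncurry b)) (hM : 0 ≤ CLin)
    (hCX : 0 ≤ CX) (hγ : 0 ≤ γ) (hγ1 : γ ≤ 1/2)
    (hlin : ∀ t ∈ Icc (0 : ℝ) T, ∀ x, ‖b t x‖ ≤ CLin * (1 + ‖x‖))
    (hX : ∀ s ∈ Icc 0 T, ∀ t ∈ Icc 0 T, ‖X t - X s‖ ≤ CX * |t - s| ^ γ)
    (hc : ContinuousOn c (Icc 0 T)) {x : E}
    (hflow : ∀ t ∈ Icc (0 : ℝ) T, c t = x + (∫ r in (0 : ℝ)..t, b r (c r)) + X t)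
    {s t : ℝ} (hs : s ∈ Icc 0 T) (ht : t ∈ Icc 0 T) (hR : ‖c s‖ ≤ R ∨ ‖c t‖ ≤ R) :
    ‖∫ r in s..t, b r (c r)‖ ≤ driftConst R T CLin * (1 + CX) * |t - s| ^ (2 * γ) ∧
      ‖c t - c s‖ ≤ driftConst R T CLin * (1 + CX) * |t - s| ^ γ := by
  have heq := fun s hs t ht =>
    sub_eq_integral_add_sub_of_flow (s := s) (t := t) hb hlin hc hflow hs ht
  have h := norm_integral_drift_le hM hCX hγ (by linarith) hc (fun r hr => hlin r hr (c r)) hX heq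
    hs ht hR
  have hT : 0 ≤ T := hs.1.trans hs.2
  have hR0 : 0 ≤ R := by rcases hR with h | h <;> exact (norm_nonneg _).trans h
  have hδ := abs_sub_le_of_mem_Icc hs ht
  set P := (1 + R) * (1 + T) * Real.exp (CLin * T) with hP
  have hP1 : 1 ≤ P * (1 + T) := by
    simpa [driftConst] using one_le_driftConst (M := 0) hR0 hT le_rfl |>.trans (by
      have : 1 ≤ Real.exp (CLin * T) := Real.one_le_exp (by positivity)
      rw [hP, driftConst, zero_mul, Real.exp_zero, add_zero, one_mul, mul_one]
      exact mul_le_mul_of_nonneg_right (le_mul_of_one_le_right (by positivity) this)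
        (by linarith))
  have hP0 : 0 ≤ P := by positivity
  have hpow : ∀ α : ℝ, 0 ≤ α → α ≤ 1 →
      ‖∫ r in s..t, b r (c r)‖ ≤ CLin * (P * (1 + T)) * (1 + CX) * |t - s| ^ α := by
    intro α h0 h1
    calc _ ≤ CLin * P * (1 + CX) * |t - s| := h
      _ ≤ CLin * P * (1 + CX) * ((1 + T) * |t - s| ^ α) := by
        gcongr
        exact le_one_add_mul_rpow (abs_nonneg _) hδ h0 h1
      _ = _ := by ring
  have hd : driftConst R T CLin = CLin * (P * (1 + T)) + P * (1 + T) := by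
    rw [driftConst, hP]; ring
  constructor
  · refine (hpow (2 * γ) (by linarith) (by linarith)).trans ?_
    rw [hd]
    gcongr
    exact le_add_of_nonneg_right (by positivity)
  · rw [heq s hs t ht]
    refine (norm_add_le _ _).trans ?_
    calc _ ≤ CLin * (P * (1 + T)) * (1 + CX) * |t - s| ^ γ + (1 + CX) * |t - s| ^ γ := by
          gcongr
          · exact hpow γ hγ (by linarith)
          · refine (hX s hs t ht).trans ?_
            gcongr
            linarith
      _ ≤ CLin * (P * (1 + T)) * (1 + CX) * |t - s| ^ γ
            + (P * (1 + T)) * ((1 + CX) * |t - s| ^ γ) := by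
          exact add_le_add le_rfl (le_mul_of_one_le_left (by positivity) hP1)
      _ = _ := by rw [hd]; ring

/-- The Jacobian of the flow along a trajectory. -/
def flowJacobian (b : ℝ → E → E) (c : ℝ → E) (t : ℝ) : ℝ :=
  Real.exp (∫ q in (0 : ℝ)..t, LinearMap.trace ℝ E (fderiv ℝ (b q) (c q)).toLinearMap)

lemma flowJacobian_le_and_abs_sub_le (hb : Measurable (uncurry b)) (hN : 0 ≤ Cdiv)
    (hd : ∀ t ∈ Icc (0 : ℝ) T, Differentiable ℝ (b t))
    (hdiv : ∀ t ∈ Icc (0 : ℝ) T, ∀ x,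
      |LinearMap.trace ℝ E (fderiv ℝ (b t) x).toLinearMap| ≤ Cdiv)
    (hc : ContinuousOn c (Icc 0 T)) {s t : ℝ} (hs : s ∈ Icc 0 T) (ht : t ∈ Icc 0 T) :
    flowJacobian b c s ≤ Real.exp (Cdiv * T) * flowJacobian b c t ∧
      ∀ α : ℝ, 0 ≤ α → α ≤ 1 → |flowJacobian b c t - flowJacobian b c s| ≤
        flowJacobian b c s * (jacobianConst T Cdiv * |t - s| ^ α) := by
  have hi : IntegrableOn
      (fun r => LinearMap.trace ℝ E (fderiv ℝ (b r) (c r)).toLinearMap) (Icc 0 T) :=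
    Integrable.mono' (g := fun _ => Cdiv) (integrableOn_const (by simp))
      (aestronglyMeasurable_trace_fderiv_comp hb measurableSet_Icc hc hd)
      (ae_restrict_of_forall_mem measurableSet_Icc fun r hr => hdiv r hr _)
  have hδ := abs_sub_le_of_mem_Icc hs ht
  have hT : 0 ≤ T := hs.1.trans hs.2
  have h : |(∫ q in (0 : ℝ)..t, LinearMap.trace ℝ E (fderiv ℝ (b q) (c q)).toLinearMap) -
      ∫ q in (0 : ℝ)..s, LinearMap.trace ℝ E (fderiv ℝ (b q) (c q)).toLinearMap| ≤
      Cdiv * |t - s| := by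
    rw [integral_sub_integral_of_integrableOn_Icc hi hs ht]
    rw [← Real.norm_eq_abs]
    exact intervalIntegral.norm_integral_le_of_norm_le_const fun r hr => hdiv r
      ((convex_Icc (0 : ℝ) T).ordConnected.uIcc_subset hs ht (uIoc_subset_uIcc hr)) _
  have h' : Cdiv * |t - s| ≤ Cdiv * T := by gcongr
  constructor
  · rw [flowJacobian, flowJacobian, ← Real.exp_add, Real.exp_le_exp]
    linarith [(abs_le.1 (h.trans h')).1]
  · intro α h0 h1
    refine (abs_exp_sub_exp_le _ _).trans ?_
    refine mul_le_mul_of_nonneg_left ?_ (Real.exp_pos _).le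
    calc _ ≤ (Cdiv * |t - s|) * Real.exp (Cdiv * T) := by
          gcongr
          exact h.trans h'
      _ ≤ (Cdiv * ((1 + T) * |t - s| ^ α)) * Real.exp (Cdiv * T) := by
          gcongr
          exact le_one_add_mul_rpow (abs_nonneg _) hδ h0 h1
      _ = _ := by rw [jacobianConst]; ring

end Flow

/-- Smooth compactly supported functions are bounded and Lipschitz, and vanish outside a ball. -/
lemma exists_bound_lipschitz_of_hasCompactSupport {E F : Type*} [NormedAddCommGroup E]
    [NormedSpace ℝ E] [NormedAddCommGroup F] [NormedSpace ℝ F] {g : E → F}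
    (hg : ContDiff ℝ 1 g) (hgc : HasCompactSupport g) :
    ∃ Λ R : ℝ, 0 ≤ Λ ∧ 0 ≤ R ∧ (∀ x, ‖g x‖ ≤ Λ) ∧ (∀ x y, ‖g y - g x‖ ≤ Λ * ‖y - x‖) ∧
      ∀ x, R < ‖x‖ → g x = 0 := by
  obtain ⟨M, hM⟩ := hgc.exists_bound_of_continuous hg.continuous
  obtain ⟨L, hL⟩ := hg.lipschitzWith_of_hasCompactSupport hgc one_ne_zero
  obtain ⟨R, hR⟩ := hgc.isCompact.isBounded.subset_closedBall 0
  refine ⟨max M L, max R 0, le_max_of_le_right L.2, le_max_right _ _,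
    fun x => (hM x).trans (le_max_left _ _), fun x y => (hL.norm_sub_le y x).trans ?_,
    fun x hx => image_eq_zero_of_notMem_tsupport fun h => ?_⟩
  · gcongr
    exact le_max_right _ _
  · have := hR h
    rw [mem_closedBall_zero_iff] at this
    exact absurd ((le_max_left R 0).trans_lt hx) this.not_gt

lemma norm_integral_smul_le_of_eq_zero_of_notMem {E F : Type*} [MeasurableSpace E]
    [NormedAddCommGroup F] [NormedSpace ℝ F] {μ : Measure E} {K : Set E} (hK : μ K ≠ ⊤)
    {u : E → ℝ} {f : E → F} {C₀ Λ : ℝ} (hC₀ : 0 ≤ C₀) (hu : ∀ x, |u x| ≤ C₀)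
    (hf : ∀ x, ‖f x‖ ≤ Λ) (hf0 : ∀ x, x ∉ K → f x = 0) :
    ‖∫ x, u x • f x ∂μ‖ ≤ C₀ * Λ * μ.real K := by
  rw [← setIntegral_eq_integral_of_forall_compl_eq_zero (s := K)
    (fun x hx => by rw [hf0 x hx, smul_zero])]
  refine norm_setIntegral_le_of_norm_le_const hK.lt_top fun x _ => ?_
  rw [norm_smul]
  exact mul_le_mul (hu x) (hf x) (norm_nonneg _) hC₀

lemma sq_mul_add_mul_add_le {Q κ x : ℝ} (hQ : 0 ≤ Q) (hκ : 0 ≤ κ) (hx : 1 ≤ x) :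
    (Q * x) ^ 2 + Q * x + κ ≤ (Q ^ 2 + Q + κ) * x ^ 2 := by
  have h : 1 ≤ x ^ 2 := one_le_pow₀ hx
  have h' : x ≤ x ^ 2 := le_self_pow₀ hx two_ne_zero
  calc (Q * x) ^ 2 + Q * x + κ = Q ^ 2 * x ^ 2 + Q * x + κ * 1 := by ring
    _ ≤ Q ^ 2 * x ^ 2 + Q * x ^ 2 + κ * x ^ 2 := by gcongr
    _ = _ := by ring

/-- the pairing `u(∇φ)` is controlled by `X`, Lemma `smooth_control`.
For `1/3 < γ ≤ 1/2`, `b` of linear growth with bounded divergence, a `γ`-Hölder driver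
`X` with `X 0 = 0`, a flow `Φ` whose time-`t` maps are `C¹`-diffeomorphisms (with
inverse `Ψ t`) whose Jacobians obey `det DΦ_t(x) = exp(∫_0^t div b_q(Φ_q(x)) dq)`, and
`u₀ ∈ L^∞`, the path `t ↦ ∫ u₀(Ψ_t(x)) ∇φ(x) dx` is controlled by `X`, with controlled
norm at most `C_D(φ) ‖u₀‖_∞ (1+‖X‖_γ)^{1+1/γ}`, where `C_D(φ)` depends only on `γ`,
`φ`, `T`, `‖b‖_{∞;Lin}` and `‖div b‖_∞` and is nondecreasing in the last three. -/
theorem stmt12 (d : ℕ) (γ : ℝ) (hγ0 : 1/3 < γ) (hγ1 : γ ≤ 1/2)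
    (φ : Euc d → ℝ) (hφ : ContDiff ℝ (⊤ : ℕ∞) φ) (hφc : HasCompactSupport φ) :
    ∃ C : ℝ → ℝ → ℝ → ℝ,
      (∀ T₁ T₂ M₁ M₂ N₁ N₂ : ℝ, T₁ ≤ T₂ → M₁ ≤ M₂ → N₁ ≤ N₂ →
        C T₁ M₁ N₁ ≤ C T₂ M₂ N₂) ∧
      ∀ (T : ℝ), 0 < T → ∀ (CLin Cdiv : ℝ),
      ∀ (b : ℝ → Euc d → Euc d) (X : ℝ → Euc d) (Φ Ψ : ℝ → Euc d → Euc d)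
        (u₀ : Euc d → ℝ) (C₀ CX : ℝ),
        Measurable (Function.uncurry b) →
        (∀ t ∈ Icc (0:ℝ) T, ContDiff ℝ 1 (b t)) →
        (∀ t ∈ Icc (0:ℝ) T, ∀ x : Euc d, ‖b t x‖ ≤ CLin * (1 + ‖x‖)) →
        (∀ t ∈ Icc (0:ℝ) T, ∀ x : Euc d,
          |LinearMap.trace ℝ (Euc d) (fderiv ℝ (b t) x).toLinearMap| ≤ Cdiv) →
        X 0 = 0 →
        (∀ s ∈ Icc (0:ℝ) T, ∀ t ∈ Icc (0:ℝ) T, ‖X t - X s‖ ≤ CX * |t - s| ^ γ) →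
        (∀ x : Euc d, ContinuousOn (fun t => Φ t x) (Icc (0:ℝ) T)) →
        (∀ x : Euc d, ∀ t ∈ Icc (0:ℝ) T,
          Φ t x = x + (∫ r in (0:ℝ)..t, b r (Φ r x)) + X t) →
        (∀ t ∈ Icc (0:ℝ) T, ContDiff ℝ 1 (Φ t) ∧ ContDiff ℝ 1 (Ψ t) ∧
          Function.LeftInverse (Ψ t) (Φ t) ∧ Function.RightInverse (Ψ t) (Φ t)) →
        (∀ t ∈ Icc (0:ℝ) T, ∀ x : Euc d,
          LinearMap.det (fderiv ℝ (Φ t) x).toLinearMap =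
            Real.exp (∫ q in (0:ℝ)..t,
              LinearMap.trace ℝ (Euc d) (fderiv ℝ (b q) (Φ q x)).toLinearMap)) →
        Measurable u₀ → (∀ x : Euc d, |u₀ x| ≤ C₀) →
        ∃ Y' : ℝ → (Euc d →L[ℝ] Euc d),
          let B : ℝ := C T CLin Cdiv * C₀ * (1 + CX) ^ (1 + 1/γ)
          (∀ s ∈ Icc (0:ℝ) T, ∀ t ∈ Icc (0:ℝ) T,
            ‖(∫ x : Euc d, u₀ (Ψ t x) • gradient φ x) -
              (∫ x : Euc d, u₀ (Ψ s x) • gradient φ x)‖ ≤ B * |t - s| ^ γ ∧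
            ‖Y' t - Y' s‖ ≤ B * |t - s| ^ γ ∧
            ‖(∫ x : Euc d, u₀ (Ψ t x) • gradient φ x) -
              (∫ x : Euc d, u₀ (Ψ s x) • gradient φ x) -
              Y' s (X t - X s)‖ ≤ B * |t - s| ^ (2 * γ)) ∧
          ‖∫ x : Euc d, u₀ (Ψ 0 x) • gradient φ x‖ + ‖Y' 0‖ ≤ B := by
  set g : Euc d → Euc d := gradient φ
  have hg : ContDiff ℝ (⊤ : ℕ∞) g :=
    (InnerProductSpace.toDual ℝ (Euc d)).symm.contDiff.comp
      (hφ.fderiv_right (m := (⊤ : ℕ∞)) (by simp))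
  have hgc : HasCompactSupport g :=
    (hφc.fderiv ℝ).comp_left (g := (InnerProductSpace.toDual ℝ (Euc d)).symm) (map_zero _)
  have hH : ContDiff ℝ 1 (fderiv ℝ g) :=
    (hg.fderiv_right (m := (⊤ : ℕ∞)) (by simp)).of_le (by simp)
  have hHc : HasCompactSupport (fderiv ℝ g) := hgc.fderiv ℝ
  obtain ⟨L₁, R₁, hL₁, hR₁, hg1, hgL1, hg01⟩ :=
    exists_bound_lipschitz_of_hasCompactSupport (hg.of_le (by simp)) hgc
  obtain ⟨L₂, R₂, hL₂, hR₂, hH2, hHL2, hH02⟩ :=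
    exists_bound_lipschitz_of_hasCompactSupport hH hHc
  set Λ := max L₁ L₂
  set R := max R₁ R₂
  have hΛ : 0 ≤ Λ := le_max_of_le_left hL₁
  have hR : 0 ≤ R := le_max_of_le_left hR₁
  have hgΛ : ∀ x, ‖g x‖ ≤ Λ := fun x => (hg1 x).trans (le_max_left _ _)
  have hHΛ : ∀ x, ‖fderiv ℝ g x‖ ≤ Λ := fun x => (hH2 x).trans (le_max_right _ _)
  have hgL : ∀ x y, ‖g y - g x‖ ≤ Λ * ‖y - x‖ := fun x y => (hgL1 x y).trans <| by
    gcongr; exact le_max_left _ _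
  have hHL : ∀ x y, ‖fderiv ℝ g y - fderiv ℝ g x‖ ≤ Λ * ‖y - x‖ :=
    fun x y => (hHL2 x y).trans <| by gcongr; exact le_max_right _ _
  set K : Set (Euc d) := Metric.closedBall 0 R
  have hKm : MeasurableSet K := Metric.isClosed_closedBall.measurableSet
  have hKfin : volume K ≠ ⊤ := measure_closedBall_lt_top.ne
  have hKlt : ∀ x, x ∉ K → R < ‖x‖ := fun x hx => by simpa [K] using hx
  have hg0 : ∀ x, x ∉ K → g x = 0 := fun x hx =>
    hg01 x ((le_max_left R₁ R₂).trans_lt (hKlt x hx))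
  have hH0 : ∀ x, x ∉ K → fderiv ℝ g x = 0 := fun x hx =>
    hH02 x ((le_max_right R₁ R₂).trans_lt (hKlt x hx))
  set V := volume.real K
  have hV : 0 ≤ V := measureReal_nonneg
  refine ⟨fun T M N => controlConst R V Λ (max T 0) (max M 0) (max N 0), ?_, ?_⟩
  · intro T₁ T₂ M₁ M₂ N₁ N₂ hT hM hN
    exact controlConst_mono hR hV hΛ (le_max_right _ _) (le_max_right _ _) (le_max_right _ _)
      (max_le_max_right 0 hT) (max_le_max_right 0 hM) (max_le_max_right 0 hN)
  intro T hT CLin Cdiv b X Φ Ψ u₀ C₀ CX hb hbC hlin hdiv hX0 hX hΦc hflow hdiff hdet hu hu₀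
  have h0T : (0 : ℝ) ∈ Icc 0 T := ⟨le_rfl, hT.le⟩
  have hM : 0 ≤ CLin := by simpa using (norm_nonneg _).trans (hlin 0 h0T 0)
  have hN : 0 ≤ Cdiv := (abs_nonneg _).trans (hdiv 0 h0T 0)
  have hC₀ : 0 ≤ C₀ := (abs_nonneg _).trans (hu₀ 0)
  have hCX : 0 ≤ CX := by
    have h := (norm_nonneg _).trans (hX 0 h0T T ⟨hT.le, le_rfl⟩)
    exact nonneg_of_mul_nonneg_left h (Real.rpow_pos_of_pos (by simpa using hT.ne') _)
  have hγ : 0 ≤ γ := by linarith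
  have hX1 : 1 ≤ 1 + CX := by linarith
  set J : ℝ → Euc d → ℝ := fun t y => flowJacobian b (fun r => Φ r y) t
  have hJ0 : ∀ t y, 0 ≤ J t y := fun t y => (Real.exp_pos _).le
  have hΦd : ∀ t ∈ Icc 0 T, Differentiable ℝ (Φ t) := fun t ht =>
    (hdiff t ht).1.differentiable one_ne_zero
  have hbij : ∀ t ∈ Icc 0 T, Bijective (Φ t) := fun t ht =>
    ⟨(hdiff t ht).2.2.1.injective, (hdiff t ht).2.2.2.surjective⟩
  have hJ : ∀ t ∈ Icc 0 T, ∀ y, LinearMap.det (fderiv ℝ (Φ t) y).toLinearMap = J t y := hdet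
  have hJcmp := fun y s hs t ht => flowJacobian_le_and_abs_sub_le (c := fun r => Φ r y) (s := s)
    (t := t) hb hN (fun t ht => (hbC t ht).differentiable one_ne_zero) hdiv (hΦc y) hs ht
  have hinc := fun y s hs t ht hR => norm_drift_le_and_norm_increment_le (R := R)
    (c := fun r => Φ r y) (s := s) (t := t) hb hM hCX hγ hγ1 hlin hX (hΦc y) (hflow y) hs ht hR
  have hsub := fun y s hs t ht => sub_eq_integral_add_sub_of_flow (c := fun r => Φ r y) (s := s)
    (t := t) hb hlin (hΦc y) (hflow y) hs ht
  set Q := driftConst R T CLin with hQ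
  have hQ1 : 1 ≤ Q := one_le_driftConst hR hT.le hM
  set κ := jacobianConst T Cdiv with hκ
  have hκ0 : 0 ≤ κ := by rw [hκ, jacobianConst]; positivity
  set A := Λ * (Q ^ 2 + Q + κ) * (1 + CX) ^ 2 with hA
  have hA0 : 0 ≤ A := by positivity
  have hpow : (1 + CX) ^ 2 ≤ (1 + CX) ^ (1 + 1 / γ) := by
    rw [← Real.rpow_natCast]
    refine Real.rpow_le_rpow_of_exponent_le (by linarith) ?_
    have : 1 ≤ 1 / γ := by rw [le_div_iff₀ (by linarith)]; linarith
    push_cast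
    linarith
  have hconst : C₀ * (Real.exp (Cdiv * T) * A * (2 * V)) ≤
      controlConst R V Λ (max T 0) (max CLin 0) (max Cdiv 0) * C₀ * (1 + CX) ^ (1 + 1 / γ) := by
    rw [max_eq_left hT.le, max_eq_left hM, max_eq_left hN, controlConst, ← hQ, ← hκ, hA]
    calc _ = Real.exp (Cdiv * T) * (Λ * (Q ^ 2 + Q + κ)) * (2 * V) * C₀ * (1 + CX) ^ 2 := by ring
      _ ≤ _ := by gcongr
  have hweight : ∀ {F : Type} [NormedAddCommGroup F] [NormedSpace ℝ F] (G : Euc d → F) (a : ℝ),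
      0 ≤ a → ∀ s ∈ Icc 0 T, ∀ t ∈ Icc 0 T,
      (∀ y, Φ s y ∈ K ∨ Φ t y ∈ K → ‖G y‖ ≤ J s y * (A * a)) →
      (∀ y, Φ s y ∉ K → Φ t y ∉ K → G y = 0) → ‖∫ y, u₀ y • G y‖ ≤
        controlConst R V Λ (max T 0) (max CLin 0) (max Cdiv 0) * C₀ * (1 + CX) ^ (1 + 1 / γ) *
          a := by
    intro F _ _ G a ha s hs t ht hG hG0
    have hE : 1 ≤ Real.exp (Cdiv * T) := Real.one_le_exp (by positivity)
    have h := norm_integral_smul_le_of_norm_le_weights (μ := volume) hKm hKfin (hΦd s hs)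
      (hbij s hs) (hJ s hs) (hJ0 s) (hΦd t ht) (hbij t ht) (hJ t ht) (hJ0 t)
      (a := Real.exp (Cdiv * T) * (A * a)) (by positivity) hu₀ (G := G) (fun y hy => ⟨?_, ?_⟩) hG0
    · calc _ ≤ C₀ * (Real.exp (Cdiv * T) * A * (2 * V)) * a := by refine h.trans_eq ?_; ring
        _ ≤ _ := by gcongr
    · calc _ ≤ J s y * (A * a) := hG y hy
        _ ≤ Real.exp (Cdiv * T) * (J s y * (A * a)) :=
          le_mul_of_one_le_left (mul_nonneg (hJ0 s y) (by positivity)) hE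
        _ = _ := by ring
    · calc _ ≤ J s y * (A * a) := hG y hy
        _ ≤ Real.exp (Cdiv * T) * J t y * (A * a) := by
          gcongr
          exact (hJcmp y s hs t ht).1
        _ = _ := by ring
  have hpair : ∀ {F : Type} [NormedAddCommGroup F] [NormedSpace ℝ F] (f : Euc d → F),
      ∀ t ∈ Icc 0 T, ∫ x, u₀ (Ψ t x) • f x = ∫ y, u₀ y • (J t y • f (Φ t y)) := by
    intro F _ _ f t ht
    rw [integral_eq_integral_smul_comp_of_det_fderiv_eq (hΦd t ht) (hbij t ht) (hJ t ht) (hJ0 t)]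
    refine integral_congr_ae (ae_of_all _ fun y => ?_)
    simp only [(hdiff t ht).2.2.1 y]
    rw [smul_comm]
  have hintΨ : ∀ {F : Type} [NormedAddCommGroup F] [NormedSpace ℝ F] (f : Euc d → F),
      Continuous f → HasCompactSupport f → ∀ t ∈ Icc 0 T,
      Integrable (fun x => u₀ (Ψ t x) • f x) := by
    intro F _ _ f hf hfc t ht
    refine (hf.integrable_of_hasCompactSupport hfc).bdd_smul C₀ ?_
      (ae_of_all _ fun x => hu₀ _)
    exact (hu.comp (hdiff t ht).2.1.continuous.measurable).aestronglyMeasurable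
  have hint : ∀ {F : Type} [NormedAddCommGroup F] [NormedSpace ℝ F] (f : Euc d → F),
      Continuous f → HasCompactSupport f → ∀ t ∈ Icc 0 T,
      Integrable (fun y => u₀ y • (J t y • f (Φ t y))) := by
    intro F _ _ f hf hfc t ht
    refine (integrable_smul_comp_of_det_fderiv_eq (hΦd t ht) (hbij t ht) (hJ t ht) (hJ0 t)
      (hintΨ f hf hfc t ht)).congr (ae_of_all _ fun y => ?_)
    simp only [(hdiff t ht).2.2.1 y]
    rw [smul_comm]
  have hfirst : ∀ {F : Type} [NormedAddCommGroup F] [NormedSpace ℝ F] (f : Euc d → F),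
      Continuous f → HasCompactSupport f → (∀ x, ‖f x‖ ≤ Λ) →
      (∀ x y, ‖f y - f x‖ ≤ Λ * ‖y - x‖) → (∀ x, x ∉ K → f x = 0) →
      ∀ s ∈ Icc 0 T, ∀ t ∈ Icc 0 T,
      ‖(∫ x, u₀ (Ψ t x) • f x) - ∫ x, u₀ (Ψ s x) • f x‖ ≤
        controlConst R V Λ (max T 0) (max CLin 0) (max Cdiv 0) * C₀ * (1 + CX) ^ (1 + 1 / γ) *
          |t - s| ^ γ := by
    intro F _ _ f hf hfc hfΛ hfL hf0 s hs t ht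
    rw [hpair f t ht, hpair f s hs, ← integral_sub (hint f hf hfc t ht) (hint f hf hfc s hs)]
    simp_rw [← smul_sub]
    refine hweight _ _ (by positivity) s hs t ht (fun y hy => ?_) fun y hy hy' => ?_
    · refine (norm_smul_sub_smul_le (hJ0 s y) hfΛ hfL).trans ?_
      have h1 := (hinc y s hs t ht (by simpa [K] using hy)).2
      have h2 := (hJcmp y s hs t ht).2 γ hγ (by linarith)
      have h3 : Q * (1 + CX) + κ ≤ (Q ^ 2 + Q + κ) * (1 + CX) ^ 2 := by
        linarith [sq_mul_add_mul_add_le (zero_le_one.trans hQ1) hκ0 hX1, sq_nonneg (Q * (1 + CX))]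
      calc _ ≤ J s y * (Λ * (Q * (1 + CX) * |t - s| ^ γ)) + J s y * (κ * |t - s| ^ γ) * Λ := by
            have := hJ0 s y
            gcongr
        _ = J s y * (Λ * (Q * (1 + CX) + κ) * |t - s| ^ γ) := by ring
        _ ≤ J s y * (Λ * ((Q ^ 2 + Q + κ) * (1 + CX) ^ 2) * |t - s| ^ γ) := by
            have := hJ0 s y
            gcongr
        _ = _ := by rw [hA]; ring
    · simp [hf0 _ hy, hf0 _ hy']
  have hgcont := hg.continuous
  refine ⟨fun s => ∫ x, u₀ (Ψ s x) • fderiv ℝ g x, fun s hs t ht => ⟨?_, ?_, ?_⟩, ?_⟩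
  · exact hfirst g hgcont hgc hgΛ hgL hg0 s hs t ht
  · exact hfirst (fderiv ℝ g) hH.continuous hHc hHΛ hHL hH0 s hs t ht
  · have hY : (∫ x, u₀ (Ψ s x) • fderiv ℝ g x) (X t - X s) =
        ∫ y, u₀ y • (J s y • fderiv ℝ g (Φ s y) (X t - X s)) := by
      rw [hpair _ s hs, ContinuousLinearMap.integral_apply (hint _ hH.continuous hHc s hs)]
      rfl
    have hYi : Integrable fun y => u₀ y • (J s y • fderiv ℝ g (Φ s y) (X t - X s)) :=
      (hint _ hH.continuous hHc s hs).apply_continuousLinearMap (X t - X s)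
    beta_reduce
    have hdi : Integrable fun y => u₀ y • (J t y • g (Φ t y)) - u₀ y • (J s y • g (Φ s y)) :=
      (hint g hgcont hgc t ht).sub (hint g hgcont hgc s hs)
    rw [hY, hpair g t ht, hpair g s hs,
      ← integral_sub (hint g hgcont hgc t ht) (hint g hgcont hgc s hs), ← integral_sub hdi hYi]
    simp_rw [← smul_sub]
    refine hweight _ _ (by positivity) s hs t ht (fun y hy => ?_) fun y hy hy' => ?_
    · refine (norm_smul_sub_smul_sub_fderiv_le (hJ0 s y) hΛ (hg.differentiable (by simp)) hgΛ hHΛ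
        hHL (hsub y s hs t ht)).trans ?_
      obtain ⟨h0, h1⟩ := hinc y s hs t ht (by simpa [K] using hy)
      have h2 := (hJcmp y s hs t ht).2 (2 * γ) (by linarith) (by linarith)
      have h3 : (Q * (1 + CX)) ^ 2 + Q * (1 + CX) + κ ≤ (Q ^ 2 + Q + κ) * (1 + CX) ^ 2 :=
        sq_mul_add_mul_add_le (zero_le_one.trans hQ1) hκ0 hX1
      have h4 : (|t - s| ^ γ) ^ 2 = |t - s| ^ (2 * γ) := by
        rw [mul_comm, Real.rpow_mul (abs_nonneg _)]
        simp
      calc _ ≤ J s y * (Λ * (Q * (1 + CX) * |t - s| ^ γ) ^ 2) +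
            J s y * (Λ * (Q * (1 + CX) * |t - s| ^ (2 * γ))) +
            J s y * (κ * |t - s| ^ (2 * γ)) * Λ := by
            have := hJ0 s y
            gcongr
        _ = J s y * (Λ * ((Q * (1 + CX)) ^ 2 + Q * (1 + CX) + κ) * |t - s| ^ (2 * γ)) := by
            rw [mul_pow, h4]; ring
        _ ≤ J s y * (Λ * ((Q ^ 2 + Q + κ) * (1 + CX) ^ 2) * |t - s| ^ (2 * γ)) := by
            have := hJ0 s y
            gcongr
        _ = _ := by rw [hA]; ring
    · simp [hg0 _ hy, hg0 _ hy', hH0 _ hy]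
  · have hbound : ∀ {F : Type} [NormedAddCommGroup F] [NormedSpace ℝ F] (f : Euc d → F),
        (∀ x, ‖f x‖ ≤ Λ) → (∀ x, x ∉ K → f x = 0) →
        ‖∫ x, u₀ (Ψ 0 x) • f x‖ ≤ C₀ * Λ * V := fun f hfΛ hf0 =>
      norm_integral_smul_le_of_eq_zero_of_notMem hKfin hC₀ (fun x => hu₀ (Ψ 0 x)) hfΛ hf0
    refine le_trans ?_ hconst
    have hE : 1 ≤ Real.exp (Cdiv * T) := Real.one_le_exp (by positivity)
    have hQ2 : 1 ≤ Q ^ 2 + Q + κ := by linarith [sq_nonneg Q]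
    have hX2 : 1 ≤ (1 + CX) ^ 2 := one_le_pow₀ hX1
    calc _ ≤ C₀ * Λ * V + C₀ * Λ * V := add_le_add (hbound g hgΛ hg0) (hbound _ hHΛ hH0)
      _ = C₀ * (1 * (Λ * 1 * 1) * (2 * V)) := by ring
      _ ≤ _ := by rw [hA]; gcongr
end
end
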